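/- arXiv:0705.3383 — 2 statements merged into one kernel-verified Lean document; each statement's English description precedes it below -/
import Mathlib

section
/- Let f be a piecewise expanding C^2 unimodal map and let X : I → ℝ be bounded. Define α_{(0)}(c₁) by the twisted-cohomological-equation solution formula with v = X∘f and ω = 0, i.e. α_{(0)}(c₁) = −Σ_{j=0}^{∞} X(f^{j+1}(c₁))/(f^{j+1})'(c₁) if c_j ≠ c for all j ≥ 0 (with the analogous finite formula when the orbit of c₁ hits c). Then J(f,X) = s₁·(X(c₁) − α_{(0)}(c₁)). In particular, since s₁ < 0, J(f,X) = 0 if and only if X∘f is horizontal for f. -/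
open Set MeasureTheory Filter Topology

noncomputable section

/-- A piecewise expanding `C^r` unimodal map on `I = [a,b]` with critical (turning) point `c`:
`f` is continuous on `I`, strictly increasing on `[a,c]`, strictly decreasing on `[c,b]`,
`f(a) = f(b) = a`, and on each side the map extends to a `C^r` map (`fp`, resp. `fm`) on an
open neighbourhood (`Up`, resp. `Um`) with derivative bounded below in modulus by some `κ > 1`. -/
structure PWUnimodal (r : ℕ) where
  a : ℝ
  b : ℝ
  c : ℝ
  hac : a < c
  hcb : c < b
  f : ℝ → ℝ
  cont : ContinuousOn f (Set.Icc a b)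
  mapsI : Set.MapsTo f (Set.Icc a b) (Set.Icc a b)
  mono : StrictMonoOn f (Set.Icc a c)
  anti : StrictAntiOn f (Set.Icc c b)
  fa : f a = a
  fb : f b = a
  Up : Set ℝ
  Um : Set ℝ
  openUp : IsOpen Up
  openUm : IsOpen Um
  subUp : Set.Icc a c ⊆ Up
  subUm : Set.Icc c b ⊆ Um
  fp : ℝ → ℝ
  fm : ℝ → ℝ
  fp_eq : Set.EqOn fp f (Set.Icc a c)
  fm_eq : Set.EqOn fm f (Set.Icc c b)
  fp_smooth : ContDiffOn ℝ r fp Up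
  fm_smooth : ContDiffOn ℝ r fm Um
  κ : ℝ
  one_lt_κ : 1 < κ
  fp_exp : ∀ x ∈ Up, κ ≤ |deriv fp x|
  fm_exp : ∀ x ∈ Um, κ ≤ |deriv fm x|

namespace PWUnimodal

variable {r : ℕ}

/-- The (one-sided) derivative `f'` of a piecewise expanding unimodal map, defined via the
two smooth extensions. -/
def d (F : PWUnimodal r) (x : ℝ) : ℝ := if x ≤ F.c then deriv F.fp x else deriv F.fm x

/-- `(f^n)'(x)`, the derivative of the `n`-th iterate. -/
def dn (F : PWUnimodal r) (n : ℕ) (x : ℝ) : ℝ :=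
  ∏ i ∈ Finset.range n, F.d (F.f^[i] x)

/-- `c_k = f^k(c)`, the postcritical orbit. -/
def ck (F : PWUnimodal r) (k : ℕ) : ℝ := F.f^[k] F.c

/-- The critical point is periodic. -/
def CritPeriodic (F : PWUnimodal r) : Prop := ∃ n, 0 < n ∧ F.f^[n] F.c = F.c

/-- `f` is good: either `c` is not periodic, or `inf |(f^{n₁})'| > 2` where `n₁` is the
minimal period of `c`. -/
def Good (F : PWUnimodal r) : Prop :=
  ¬ F.CritPeriodic ∨
    ∀ x ∈ Set.Icc F.a F.b, 2 < |F.dn (Function.minimalPeriod F.f F.c) x|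

/-- `f` is topologically mixing on `[f²(c), f(c)]`. -/
def Mixing (F : PWUnimodal r) : Prop :=
  ∀ U V : Set ℝ, IsOpen U → IsOpen V →
    (U ∩ Set.Icc (F.ck 2) (F.ck 1)).Nonempty →
    (V ∩ Set.Icc (F.ck 2) (F.ck 1)).Nonempty →
    ∃ N, ∀ n ≥ N, (F.f^[n] '' (U ∩ Set.Icc (F.ck 2) (F.ck 1)) ∩ V).Nonempty

/-- `v` is horizontal for `f`: `∑_{j=0}^{M_f-1} v(c_j)/(f^j)'(c_1) = 0`, where `M_f = n₁` if
`c` is periodic of minimal period `n₁` and `M_f = ∞` otherwise. -/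
def Horizontal (F : PWUnimodal r) (v : ℝ → ℝ) : Prop :=
  (F.CritPeriodic →
    ∑ j ∈ Finset.range (Function.minimalPeriod F.f F.c), v (F.ck j) / F.dn j (F.ck 1) = 0) ∧
  (¬ F.CritPeriodic → ∑' j : ℕ, v (F.ck j) / F.dn j (F.ck 1) = 0)

open scoped Classical in
/-- `N_f = n₀ + n₁ - 1` if `c` is preperiodic, `n₁` if `c` is periodic of minimal period `n₁`,
and `∞` otherwise. -/
def Nf (F : PWUnimodal r) : ℕ∞ :=
  if F.c ∈ Function.periodicPts F.f then (Function.minimalPeriod F.f F.c : ℕ∞)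
  else if h : ∃ m, 0 < m ∧ F.f^[m] F.c ∈ Function.periodicPts F.f then
    ((Nat.find h + Function.minimalPeriod F.f (F.f^[Nat.find h] F.c) - 1 : ℕ) : ℕ∞)
  else ⊤

open scoped Classical in
/-- `M_f = n₁` if `c` is periodic of minimal period `n₁`, and `∞` otherwise. -/
def Mf (F : PWUnimodal r) : ℕ∞ :=
  if F.c ∈ Function.periodicPts F.f then (Function.minimalPeriod F.f F.c : ℕ∞) else ⊤

/-- `ρ` is the (unique) absolutely continuous invariant probability density of `f`:
a nonnegative integrable function of bounded variation, supported in `[a,b]`, of total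
integral one, whose associated measure is `f`-invariant. -/
structure IsInvDensity (F : PWUnimodal r) (ρ : ℝ → ℝ) : Prop where
  nonneg : ∀ x, 0 ≤ ρ x
  integrable : MeasureTheory.Integrable ρ
  mass : (∫ x, ρ x) = 1
  supp : Function.support ρ ⊆ Set.Icc F.a F.b
  bv : BoundedVariationOn ρ Set.univ
  invariant : ∀ φ : ℝ → ℝ, Continuous φ → (∫ x, φ (F.f x) * ρ x) = ∫ x, φ x * ρ x

end PWUnimodal

/-- Sum of `g n` over `1 ≤ n ≤ N`, where `N ∈ ℕ∞`. -/
def sumTo (N : ℕ∞) (g : ℕ → ℝ) : ℝ :=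
  ∑' n : ℕ, if 1 ≤ n ∧ (n : ℕ∞) ≤ N then g n else 0

/-- The jump function `H_u`: `-1` on `(-∞,u)`, `-1/2` at `u`, `0` on `(u,∞)`. -/
def Hfun (u x : ℝ) : ℝ := if x < u then -1 else if x = u then -(1/2) else 0

namespace PWUnimodal

variable {r : ℕ}

/-- The saltus function `∑_{n=1}^{N_f} s_n H_{c_n}`. -/
def saltus (F : PWUnimodal r) (s : ℕ → ℝ) (x : ℝ) : ℝ :=
  sumTo F.Nf (fun n => s n * Hfun (F.ck n) x)

/-- The decomposition `ρ₀ = ρ_reg + ρ_sal` of the invariant density into a continuous part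
and the saltus part `ρ_sal = ∑_{n=1}^{N_f} s_n H_{c_n}`. -/
structure SaltusDecomp (F : PWUnimodal r) (ρ₀ ρreg : ℝ → ℝ) (s : ℕ → ℝ) : Prop where
  cont : Continuous ρreg
  eq : ∀ x, ρ₀ x = ρreg x + F.saltus s x

/-- The weighted total jump `J(f,X) = ∑_{n=1}^{N_f} s_n X(c_n)`. -/
def Jfun (F : PWUnimodal r) (s : ℕ → ℝ) (X : ℝ → ℝ) : ℝ :=
  sumTo F.Nf (fun n => s n * X (F.ck n))

open scoped Classical in
/-- The solution `α_{(0)}` (with `α(c) = 0`) of the twisted cohomological equation, given by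
the explicit series/finite-sum formula. -/
def alpha0 (F : PWUnimodal r) (v : ℝ → ℝ) (x : ℝ) : ℝ :=
  if h : ∃ ℓ, 1 ≤ ℓ ∧ F.f^[ℓ] x = F.c then
    -∑ j ∈ Finset.range (Nat.find h), v (F.f^[j] x) / F.dn (j+1) x
  else -∑' j : ℕ, v (F.f^[j] x) / F.dn (j+1) x

/-- `C^r` extensions `ψ₊, ψ₋` of the two inverse branches of `f` to `J = (-∞, f(c)]`,
with derivatives bounded in modulus by some `θ < 1`. -/
structure InvBranches (F : PWUnimodal r) where
  ψp : ℝ → ℝ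
  ψm : ℝ → ℝ
  smooth_p : ContDiffOn ℝ r ψp (Set.Iic (F.f F.c))
  smooth_m : ContDiffOn ℝ r ψm (Set.Iic (F.f F.c))
  inv_p : ∀ y ∈ Set.Icc F.a (F.f F.c), ψp y ∈ Set.Icc F.a F.c ∧ F.f (ψp y) = y
  inv_m : ∀ y ∈ Set.Icc F.a (F.f F.c), ψm y ∈ Set.Icc F.c F.b ∧ F.f (ψm y) = y
  θ : ℝ
  θ_lt : θ < 1
  dψp : ∀ y ∈ Set.Iic (F.f F.c), |deriv ψp y| ≤ θ
  dψm : ∀ y ∈ Set.Iic (F.f F.c), |deriv ψm y| ≤ θ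

/-- `χ`: the indicator `1` on `(-∞, f(c))`, `1/2` at `f(c)`, `0` beyond. -/
def χ (F : PWUnimodal r) (x : ℝ) : ℝ :=
  if x < F.f F.c then 1 else if x = F.f F.c then 1/2 else 0

/-- The operator `L₀`. -/
def InvBranches.L0 {F : PWUnimodal r} (B : F.InvBranches) (φ : ℝ → ℝ) (x : ℝ) : ℝ :=
  F.χ x * φ (B.ψp x) - F.χ x * φ (B.ψm x)

/-- The Perron-Frobenius transfer operator `L₁`. -/
def InvBranches.L1 {F : PWUnimodal r} (B : F.InvBranches) (φ : ℝ → ℝ) (x : ℝ) : ℝ :=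
  F.χ x * (deriv B.ψp x * φ (B.ψp x)) + F.χ x * (|deriv B.ψm x| * φ (B.ψm x))

/-- The operator `L₀` on complex-valued functions. -/
def InvBranches.L0c {F : PWUnimodal r} (B : F.InvBranches) (φ : ℝ → ℂ) (x : ℝ) : ℂ :=
  (F.χ x : ℂ) * φ (B.ψp x) - (F.χ x : ℂ) * φ (B.ψm x)

/-- The transfer operator `L₁` on complex-valued functions. -/
def InvBranches.L1c {F : PWUnimodal r} (B : F.InvBranches) (φ : ℝ → ℂ) (x : ℝ) : ℂ :=
  (F.χ x : ℂ) * (Complex.ofReal (deriv B.ψp x) * φ (B.ψp x)) +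
    (F.χ x : ℂ) * (Complex.ofReal |deriv B.ψm x| * φ (B.ψm x))

/-- Forgetting smoothness: a piecewise expanding `C^r` unimodal map is also `C^{r'}` for
`r' ≤ r`. -/
def restrict (F : PWUnimodal r) (r' : ℕ) (h : r' ≤ r) : PWUnimodal r' :=
  { F with
    fp_smooth := F.fp_smooth.of_le (by exact_mod_cast h)
    fm_smooth := F.fm_smooth.of_le (by exact_mod_cast h) }

end PWUnimodal

/-- A `C^{r₀,r}` perturbation `(f_t)_{|t|<ε}` of a piecewise expanding `C^r` unimodal map `F`:
a family of piecewise expanding `C^r` unimodal maps on the same interval with the same turning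
point, with `f_0 = f`, uniformly bounded `C^r` norms of the one-sided extensions on fixed
neighbourhoods, `‖(f - f_t)|_{I_σ}‖_{C^{r-1}} = O(t)`, and such that `(x,t) ↦ f_t(x)` extends,
on each side, to a `C^{r₀}` function on a neighbourhood of `I_σ × {0}`. -/
structure PWFamily (r₀ r : ℕ) (F : PWUnimodal r) (ε : ℝ) where
  εpos : 0 < ε
  fam : ℝ → PWUnimodal r
  same_a : ∀ t, (fam t).a = F.a
  same_b : ∀ t, (fam t).b = F.b
  same_c : ∀ t, (fam t).c = F.c
  at0 : fam 0 = F
  Vp : Set ℝ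
  Vm : Set ℝ
  openVp : IsOpen Vp
  openVm : IsOpen Vm
  subVp : Set.Icc F.a F.c ⊆ Vp
  subVm : Set.Icc F.c F.b ⊆ Vm
  VpUp : ∀ t, |t| < ε → Vp ⊆ (fam t).Up
  VmUm : ∀ t, |t| < ε → Vm ⊆ (fam t).Um
  Cb : ℝ
  unif_p : ∀ t, |t| < ε → ∀ i ≤ r, ∀ x ∈ Vp, |iteratedDeriv i (fam t).fp x| ≤ Cb
  unif_m : ∀ t, |t| < ε → ∀ i ≤ r, ∀ x ∈ Vm, |iteratedDeriv i (fam t).fm x| ≤ Cb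
  close_p : ∀ t, |t| < ε → ∀ i ≤ r - 1, ∀ x ∈ Vp,
    |iteratedDeriv i (fun y => F.fp y - (fam t).fp y) x| ≤ Cb * |t|
  close_m : ∀ t, |t| < ε → ∀ i ≤ r - 1, ∀ x ∈ Vm,
    |iteratedDeriv i (fun y => F.fm y - (fam t).fm y) x| ≤ Cb * |t|
  Gp : ℝ × ℝ → ℝ
  Gm : ℝ × ℝ → ℝ
  Wp : Set (ℝ × ℝ)
  Wm : Set (ℝ × ℝ)
  openWp : IsOpen Wp
  openWm : IsOpen Wm
  subWp : (Set.Icc F.a F.c) ×ˢ ({0} : Set ℝ) ⊆ Wp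
  subWm : (Set.Icc F.c F.b) ×ˢ ({0} : Set ℝ) ⊆ Wm
  smoothGp : ContDiffOn ℝ r₀ Gp Wp
  smoothGm : ContDiffOn ℝ r₀ Gm Wm
  Gp_eq : ∀ t, |t| < ε → ∀ x ∈ Set.Icc F.a F.c, (x, t) ∈ Wp → Gp (x, t) = (fam t).f x
  Gm_eq : ∀ t, |t| < ε → ∀ x ∈ Set.Icc F.c F.b, (x, t) ∈ Wm → Gm (x, t) = (fam t).f x

/-- The infinitesimal deformation `v = ∂_t f_t|_{t=0}`. -/
def PWFamily.v {r₀ r : ℕ} {F : PWUnimodal r} {ε : ℝ} (P : PWFamily r₀ r F ε) (x : ℝ) : ℝ :=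
  if x ≤ F.c then deriv (fun t => P.Gp (x, t)) 0 else deriv (fun t => P.Gm (x, t)) 0

/-- A `C^{r₀,r}` perturbation staying in the topological class of `F`: each `f_t` is
conjugated to `f` by a homeomorphism `h_t` of `I` fixing `c`. -/
structure ConjFamily (r₀ r : ℕ) (F : PWUnimodal r) (ε : ℝ) extends PWFamily r₀ r F ε where
  h : ℝ → ℝ → ℝ
  h_cont : ∀ t, |t| < ε → ContinuousOn (h t) (Set.Icc F.a F.b)
  h_bij : ∀ t, |t| < ε → Set.BijOn (h t) (Set.Icc F.a F.b) (Set.Icc F.a F.b)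
  h_c : ∀ t, |t| < ε → h t F.c = F.c
  h_conj : ∀ t, |t| < ε → ∀ x ∈ Set.Icc F.a F.b, (fam t).f (h t x) = h t (F.f x)

/-- The infinitesimal conjugacy `α = ∂_t h_t|_{t=0}`. -/
def ConjFamily.alpha {r₀ r : ℕ} {F : PWUnimodal r} {ε : ℝ} (C : ConjFamily r₀ r F ε)
    (x : ℝ) : ℝ :=
  deriv (fun t => C.h t x) 0

/-- A perturbation `P` is tangent to the topological class of `F` if there is a `C^{2,2}`
perturbation `f̃_t` of `F` lying in the topological class of `F` with
`sup_x |f̃_t(x) - f_t(x)| = O(t²)`. -/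
structure PWFamily.TangentData {r₀ r : ℕ} {F : PWUnimodal r} {ε : ℝ}
    (P : PWFamily r₀ r F ε) (hr : 2 ≤ r) where
  Q : ConjFamily 2 2 (F.restrict 2 hr) ε
  K : ℝ
  close : ∀ t, |t| < ε → ∀ x ∈ Set.Icc F.a F.b, |(Q.fam t).f x - (P.fam t).f x| ≤ K * t ^ 2

/-- An abstract realization of the Banach space `BV` of bounded variation functions supported
in `[a,b]`, modulo functions differing on an at most countable set, with the variation norm. -/
structure BVRealization (a b : ℝ) (V : Type) [NormedAddCommGroup V] [NormedSpace ℂ V] where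
  toFun : V →ₗ[ℂ] (ℝ → ℂ)
  bv : ∀ φ, BoundedVariationOn (toFun φ) Set.univ
  supp : ∀ φ, Function.support (toFun φ) ⊆ Set.Icc a b
  zero_iff : ∀ φ : V, φ = 0 ↔ (Function.support (toFun φ)).Countable
  surj : ∀ g : ℝ → ℂ, BoundedVariationOn g Set.univ → Function.support g ⊆ Set.Icc a b →
    ∃ φ : V, {x | toFun φ x ≠ g x}.Countable
  norm_eq : ∀ φ : V, ENNReal.ofReal ‖φ‖ =
    ⨅ g ∈ {g : ℝ → ℂ | {x | g x ≠ toFun φ x}.Countable}, eVariationOn g Set.univ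

/-- An abstract realization of the Banach space `BV^{(1)}` of functions supported in
`(-∞, b]` whose (distributional) derivative is a function of bounded variation, with norm
`‖φ‖ = ‖φ'‖_{BV}`. -/
structure BV1Realization (a b : ℝ) (W : Type) [NormedAddCommGroup W] [NormedSpace ℂ W] where
  toFun : W →ₗ[ℂ] (ℝ → ℂ)
  inj : ∀ φ : W, toFun φ = 0 → φ = 0
  deriv_bv : ∀ φ : W, ∃ g : ℝ → ℂ, BoundedVariationOn g Set.univ ∧
    Function.support g ⊆ Set.Icc a b ∧ ∀ x, toFun φ x = -∫ t in Set.Ioc x b, g t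
  surj : ∀ g : ℝ → ℂ, BoundedVariationOn g Set.univ → Function.support g ⊆ Set.Icc a b →
    ∃ φ : W, ∀ x, toFun φ x = -∫ t in Set.Ioc x b, g t
  norm_eq : ∀ φ : W, ENNReal.ofReal ‖φ‖ =
    ⨅ g ∈ {g : ℝ → ℂ | ∀ x, toFun φ x = -∫ t in Set.Ioc x b, g t}, eVariationOn g Set.univ



namespace PWUnimodal

/-! ### Geometry of the two branches -/

lemma z_hasDeriv_p (F : PWUnimodal 2) {x : ℝ} (hx : x ∈ Icc F.a F.c) :
    HasDerivAt F.fp (deriv F.fp x) x :=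
  ((F.fp_smooth.differentiableOn (by norm_num)).differentiableAt
    (F.openUp.mem_nhds (F.subUp hx))).hasDerivAt

lemma z_hasDeriv_m (F : PWUnimodal 2) {x : ℝ} (hx : x ∈ Icc F.c F.b) :
    HasDerivAt F.fm (deriv F.fm x) x :=
  ((F.fm_smooth.differentiableOn (by norm_num)).differentiableAt
    (F.openUm.mem_nhds (F.subUm hx))).hasDerivAt

lemma z_hasDeriv_fp (F : PWUnimodal 2) {x : ℝ} (hx : x ∈ Icc F.a F.c) :
    HasDerivWithinAt F.f (deriv F.fp x) (Icc F.a F.c) x :=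
  (F.z_hasDeriv_p hx).hasDerivWithinAt.congr (fun y hy => (F.fp_eq hy).symm) (F.fp_eq hx).symm

lemma z_hasDeriv_fm (F : PWUnimodal 2) {x : ℝ} (hx : x ∈ Icc F.c F.b) :
    HasDerivWithinAt F.f (deriv F.fm x) (Icc F.c F.b) x :=
  (F.z_hasDeriv_m hx).hasDerivWithinAt.congr (fun y hy => (F.fm_eq hy).symm) (F.fm_eq hx).symm

lemma z_dp (F : PWUnimodal 2) {x : ℝ} (hx : x ∈ Icc F.a F.c) : F.κ ≤ deriv F.fp x := by
  have h0 : 0 ≤ derivWithin F.f (Icc F.a F.c) x := F.mono.monotoneOn.derivWithin_nonneg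
  rw [(F.z_hasDeriv_fp hx).derivWithin (uniqueDiffOn_Icc F.hac x hx)] at h0
  have := F.fp_exp x (F.subUp hx)
  rwa [abs_of_nonneg h0] at this

lemma z_dm (F : PWUnimodal 2) {x : ℝ} (hx : x ∈ Icc F.c F.b) : deriv F.fm x ≤ -F.κ := by
  have h0 : derivWithin F.f (Icc F.c F.b) x ≤ 0 := F.anti.antitoneOn.derivWithin_nonpos
  rw [(F.z_hasDeriv_fm hx).derivWithin (uniqueDiffOn_Icc F.hcb x hx)] at h0
  have := F.fm_exp x (F.subUm hx)
  rw [abs_of_nonpos h0] at this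
  linarith

lemma z_exp_p (F : PWUnimodal 2) {x y : ℝ} (hx : x ∈ Icc F.a F.c) (hy : y ∈ Icc F.a F.c)
    (hxy : x ≤ y) : F.κ * (y - x) ≤ F.f y - F.f x := by
  rw [← F.fp_eq hx, ← F.fp_eq hy]
  refine Convex.mul_sub_le_image_sub_of_le_deriv (convex_Icc F.a F.c)
    (fun z hz => (F.z_hasDeriv_p hz).continuousAt.continuousWithinAt)
    (fun z hz => (F.z_hasDeriv_p (interior_subset hz)).differentiableAt.differentiableWithinAt)
    (fun z hz => F.z_dp (interior_subset hz)) x hx y hy hxy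

lemma z_exp_m (F : PWUnimodal 2) {x y : ℝ} (hx : x ∈ Icc F.c F.b) (hy : y ∈ Icc F.c F.b)
    (hxy : x ≤ y) : F.κ * (y - x) ≤ F.f x - F.f y := by
  rw [← F.fm_eq hx, ← F.fm_eq hy]
  have := Convex.image_sub_le_mul_sub_of_deriv_le (convex_Icc F.c F.b)
    (fun z hz => (F.z_hasDeriv_m hz).continuousAt.continuousWithinAt)
    (fun z hz => (F.z_hasDeriv_m (interior_subset hz)).differentiableAt.differentiableWithinAt)
    (fun z hz => F.z_dm (interior_subset hz)) x hx y hy hxy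
  linarith

lemma z_c_lt (F : PWUnimodal 2) : F.c < F.f F.c := by
  have h := F.z_exp_p (left_mem_Icc.2 F.hac.le) (right_mem_Icc.2 F.hac.le) F.hac.le
  rw [F.fa] at h
  nlinarith [F.hac, F.one_lt_κ]

lemma z_c_mem (F : PWUnimodal 2) : F.c ∈ Icc F.a F.b := ⟨F.hac.le, F.hcb.le⟩

lemma z_c1_le (F : PWUnimodal 2) : F.f F.c ≤ F.b := (F.mapsI F.z_c_mem).2

lemma z_lt_c1 (F : PWUnimodal 2) {x : ℝ} (hx : x ∈ Icc F.a F.b) (hxc : x ≠ F.c) :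
    F.f x < F.f F.c := by
  rcases lt_or_gt_of_ne hxc with h | h
  · exact F.mono ⟨hx.1, h.le⟩ (right_mem_Icc.2 F.hac.le) h
  · exact F.anti (left_mem_Icc.2 F.hcb.le) ⟨h.le, hx.2⟩ h

/-- The increasing inverse branch. -/
def ψP (F : PWUnimodal 2) (y : ℝ) : ℝ := Function.invFunOn F.f (Icc F.a F.c) y

/-- The decreasing inverse branch. -/
def ψM (F : PWUnimodal 2) (y : ℝ) : ℝ := Function.invFunOn F.f (Icc F.c F.b) y

lemma z_ex_p (F : PWUnimodal 2) {y : ℝ} (hy : y ∈ Icc F.a (F.f F.c)) :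
    ∃ x ∈ Icc F.a F.c, F.f x = y := by
  have := intermediate_value_Icc F.hac.le
    (F.cont.mono (Icc_subset_Icc_right F.hcb.le))
  rw [F.fa] at this
  exact this hy

lemma z_ex_m (F : PWUnimodal 2) {y : ℝ} (hy : y ∈ Icc F.a (F.f F.c)) :
    ∃ x ∈ Icc F.c F.b, F.f x = y := by
  have := intermediate_value_Icc' F.hcb.le
    (F.cont.mono (Icc_subset_Icc_left F.hac.le))
  rw [F.fb] at this
  exact this hy

lemma z_ψP_mem (F : PWUnimodal 2) {y : ℝ} (hy : y ∈ Icc F.a (F.f F.c)) :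
    F.ψP y ∈ Icc F.a F.c := Function.invFunOn_mem (F.z_ex_p hy)

lemma z_ψM_mem (F : PWUnimodal 2) {y : ℝ} (hy : y ∈ Icc F.a (F.f F.c)) :
    F.ψM y ∈ Icc F.c F.b := Function.invFunOn_mem (F.z_ex_m hy)

lemma z_f_ψP (F : PWUnimodal 2) {y : ℝ} (hy : y ∈ Icc F.a (F.f F.c)) :
    F.f (F.ψP y) = y := Function.invFunOn_eq (F.z_ex_p hy)

lemma z_f_ψM (F : PWUnimodal 2) {y : ℝ} (hy : y ∈ Icc F.a (F.f F.c)) :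
    F.f (F.ψM y) = y := Function.invFunOn_eq (F.z_ex_m hy)

lemma z_f_mem (F : PWUnimodal 2) {x : ℝ} (hx : x ∈ Icc F.a F.b) :
    F.f x ∈ Icc F.a (F.f F.c) := by
  refine ⟨(F.mapsI hx).1, ?_⟩
  by_cases h : x = F.c
  · rw [h]
  · exact (F.z_lt_c1 hx h).le

lemma z_ψP_f (F : PWUnimodal 2) {x : ℝ} (hx : x ∈ Icc F.a F.c) : F.ψP (F.f x) = x := by
  have h : F.f x ∈ Icc F.a (F.f F.c) := F.z_f_mem ⟨hx.1, hx.2.trans F.hcb.le⟩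
  exact F.mono.injOn (F.z_ψP_mem h) hx (F.z_f_ψP h)

lemma z_ψM_f (F : PWUnimodal 2) {x : ℝ} (hx : x ∈ Icc F.c F.b) : F.ψM (F.f x) = x := by
  have h : F.f x ∈ Icc F.a (F.f F.c) := F.z_f_mem ⟨F.hac.le.trans hx.1, hx.2⟩
  exact F.anti.injOn (F.z_ψM_mem h) hx (F.z_f_ψM h)

lemma z_ψP_mono (F : PWUnimodal 2) : StrictMonoOn F.ψP (Icc F.a (F.f F.c)) := by
  intro y hy y' hy' h
  by_contra hc
  have := F.mono.monotoneOn (F.z_ψP_mem hy') (F.z_ψP_mem hy) (not_lt.1 hc)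
  rw [F.z_f_ψP hy, F.z_f_ψP hy'] at this
  linarith

lemma z_ψM_anti (F : PWUnimodal 2) : StrictAntiOn F.ψM (Icc F.a (F.f F.c)) := by
  intro y hy y' hy' h
  by_contra hc
  have := F.anti.antitoneOn (F.z_ψM_mem hy) (F.z_ψM_mem hy') (not_lt.1 hc)
  rw [F.z_f_ψM hy, F.z_f_ψM hy'] at this
  linarith

lemma z_ψP_lip (F : PWUnimodal 2) : LipschitzOnWith 1 F.ψP (Icc F.a (F.f F.c)) := by
  refine LipschitzOnWith.of_le_add_mul 1 ?_
  intro x hx y hy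
  rw [NNReal.coe_one, one_mul, Real.dist_eq]
  rcases le_total x y with h | h
  · have := F.z_ψP_mono.monotoneOn hx hy h
    linarith [abs_nonneg (x - y)]
  · have h1 := F.z_ψP_mono.monotoneOn hy hx h
    have h2 := F.z_exp_p (F.z_ψP_mem hy) (F.z_ψP_mem hx) h1
    rw [F.z_f_ψP hx, F.z_f_ψP hy] at h2
    nlinarith [le_abs_self (x - y), F.one_lt_κ]

lemma z_ψM_lip (F : PWUnimodal 2) : LipschitzOnWith 1 F.ψM (Icc F.a (F.f F.c)) := by
  refine LipschitzOnWith.of_le_add_mul 1 ?_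
  intro x hx y hy
  rw [NNReal.coe_one, one_mul, Real.dist_eq]
  rcases le_total y x with h | h
  · have := F.z_ψM_anti.antitoneOn hy hx h
    linarith [abs_nonneg (x - y)]
  · have h1 := F.z_ψM_anti.antitoneOn hx hy h
    have h2 := F.z_exp_m (F.z_ψM_mem hy) (F.z_ψM_mem hx) h1
    rw [F.z_f_ψM hx, F.z_f_ψM hy] at h2
    nlinarith [neg_abs_le (x - y), F.one_lt_κ]

lemma z_inv_deriv {h ψ : ℝ → ℝ} {S T : Set ℝ} {m y : ℝ} (hy : y ∈ T) (hmaps : MapsTo ψ T S)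
    (hinv : ∀ z ∈ T, h (ψ z) = z) (hψ : ContinuousOn ψ T)
    (hd : HasDerivWithinAt h m S (ψ y)) (hm : m ≠ 0) :
    HasDerivWithinAt ψ m⁻¹ T y := by
  rw [hasDerivWithinAt_iff_tendsto_slope] at hd ⊢
  have hinj : InjOn ψ T := fun u hu v hv huv => by
    rw [← hinv u hu, ← hinv v hv, huv]
  have ht : Tendsto ψ (𝓝[T \ {y}] y) (𝓝[S \ {ψ y}] (ψ y)) := by
    refine tendsto_nhdsWithin_iff.2 ⟨(hψ y hy).mono_left (nhdsWithin_mono _ sdiff_subset), ?_⟩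
    filter_upwards [self_mem_nhdsWithin] with z hz
    exact ⟨hmaps hz.1, fun h => hz.2 (hinj hz.1 hy h)⟩
  refine ((hd.comp ht).inv₀ hm).congr' ?_
  filter_upwards [self_mem_nhdsWithin] with z hz
  simp only [Function.comp, slope_def_field, hinv z hz.1, hinv y hy, inv_div]

lemma z_ψP_deriv (F : PWUnimodal 2) {y : ℝ} (hy : y ∈ Icc F.a (F.f F.c)) :
    HasDerivWithinAt F.ψP (deriv F.fp (F.ψP y))⁻¹ (Icc F.a (F.f F.c)) y :=
  z_inv_deriv hy (fun _ h => F.z_ψP_mem h) (fun _ h => F.z_f_ψP h) F.z_ψP_lip.continuousOn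
    (F.z_hasDeriv_fp (F.z_ψP_mem hy))
    (by have := F.z_dp (F.z_ψP_mem hy); linarith [F.one_lt_κ])

lemma z_ψM_deriv (F : PWUnimodal 2) {y : ℝ} (hy : y ∈ Icc F.a (F.f F.c)) :
    HasDerivWithinAt F.ψM (deriv F.fm (F.ψM y))⁻¹ (Icc F.a (F.f F.c)) y :=
  z_inv_deriv hy (fun _ h => F.z_ψM_mem h) (fun _ h => F.z_f_ψM h) F.z_ψM_lip.continuousOn
    (F.z_hasDeriv_fm (F.z_ψM_mem hy))
    (by have := F.z_dm (F.z_ψM_mem hy); linarith [F.one_lt_κ])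

end PWUnimodal

namespace PWUnimodal

/-! ### The distribution function of the invariant density -/

lemma z_inv_set (F : PWUnimodal 2) {ρ : ℝ → ℝ} (hρ : F.IsInvDensity ρ) {A : Set ℝ}
    (hA : MeasurableSet A) :
    ∃ g : ℝ → ℝ, Continuous g ∧ EqOn g F.f (Icc F.a F.b) ∧
      ∫ x in g ⁻¹' A, ρ x = ∫ x in A, ρ x := by
  have hab : F.a ≤ F.b := F.hac.le.trans F.hcb.le
  let g : ℝ → ℝ := IccExtend hab ((Icc F.a F.b).domRestrict F.f)
  have hg : Continuous g := F.cont.domRestrict.Icc_extend'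
  have hgf : EqOn g F.f (Icc F.a F.b) := fun x hx => by
    simp only [g]
    rw [IccExtend_of_mem _ _ hx]; rfl
  refine ⟨g, hg, hgf, ?_⟩
  let μ : Measure ℝ := volume.withDensity (fun x => ENNReal.ofReal (ρ x))
  have hae : AEMeasurable (fun x => ENNReal.ofReal (ρ x)) volume :=
    hρ.integrable.aestronglyMeasurable.aemeasurable.ennreal_ofReal
  have : IsFiniteMeasure μ := by
    refine isFiniteMeasure_withDensity_ofReal hρ.integrable.2
  have hIntEq : ∀ φ : ℝ → ℝ, ∫ x, φ x ∂μ = ∫ x, φ x * ρ x := by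
    intro φ
    simp only [μ]
    rw [integral_withDensity_eq_integral_toReal_smul₀ hae (by simp)]
    refine integral_congr_ae (Eventually.of_forall fun x => ?_)
    simp only [smul_eq_mul, ENNReal.toReal_ofReal (hρ.nonneg x)]
    ring
  have hmap : μ.map g = μ := by
    refine ext_of_forall_integral_eq_of_IsFiniteMeasure fun φ => ?_
    rw [integral_map hg.aemeasurable φ.continuous.aestronglyMeasurable, hIntEq, hIntEq,
      ← hρ.invariant φ φ.continuous]
    refine integral_congr_ae (Eventually.of_forall fun x => ?_)
    simp only
    by_cases hx : x ∈ Icc F.a F.b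
    · rw [hgf hx]
    · have : ρ x = 0 := by
        by_contra h
        exact hx (hρ.supp h)
      simp [this]
  have hμ : ∀ B, MeasurableSet B → μ B = ENNReal.ofReal (∫ x in B, ρ x) := by
    intro B hB
    rw [withDensity_apply _ hB, ofReal_integral_eq_lintegral_ofReal hρ.integrable.integrableOn
      (Eventually.of_forall hρ.nonneg)]
  have h1 := hμ _ hA
  have h2 := hμ _ (hg.measurable hA)
  rw [← Measure.map_apply hg.measurable hA, hmap, h1] at h2
  exact ((ENNReal.ofReal_eq_ofReal_iff (integral_nonneg hρ.nonneg)
    (integral_nonneg hρ.nonneg)).1 h2).symm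

lemma z_restr (F : PWUnimodal 2) {ρ : ℝ → ℝ} (hρ : F.IsInvDensity ρ) {A : Set ℝ}
    (hA : MeasurableSet A) : ∫ x in A, ρ x = ∫ x in A ∩ Icc F.a F.b, ρ x := by
  refine setIntegral_eq_of_subset_of_forall_sdiff_eq_zero hA inter_subset_left fun x hx => ?_
  by_contra h
  exact hx.2 ⟨hx.1, hρ.supp h⟩

lemma z_mass (F : PWUnimodal 2) {ρ : ℝ → ℝ} (hρ : F.IsInvDensity ρ) :
    ∫ x in Icc F.a F.b, ρ x = 1 := by
  have := F.z_restr hρ MeasurableSet.univ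
  rw [univ_inter, setIntegral_univ, hρ.mass] at this
  exact this.symm

/-- The distribution function. -/
def Gd (F : PWUnimodal 2) (ρ : ℝ → ℝ) (y : ℝ) : ℝ := ∫ t in F.a..y, ρ t

lemma z_G_total (F : PWUnimodal 2) {ρ : ℝ → ℝ} (hρ : F.IsInvDensity ρ) :
    F.Gd ρ F.b = 1 := by
  have hab : F.a ≤ F.b := F.hac.le.trans F.hcb.le
  rw [Gd, intervalIntegral.integral_of_le hab, ← integral_Icc_eq_integral_Ioc,
    F.z_mass hρ]

lemma z_G_Iio (F : PWUnimodal 2) {ρ : ℝ → ℝ} (hρ : F.IsInvDensity ρ) {y : ℝ}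
    (hy : F.a ≤ y) : ∫ x in Iio y, ρ x = F.Gd ρ y := by
  rw [Gd, intervalIntegral.integral_of_le hy, ← integral_Ico_eq_integral_Ioc]
  refine setIntegral_eq_of_subset_of_forall_sdiff_eq_zero measurableSet_Iio
    (fun x hx => hx.2) fun x hx => ?_
  by_contra h
  exact hx.2 ⟨(hρ.supp h).1, hx.1⟩

lemma z_G_Ioi (F : PWUnimodal 2) {ρ : ℝ → ℝ} (hρ : F.IsInvDensity ρ) {y : ℝ}
    (hy : y ≤ F.b) : ∫ x in Ioc y F.b, ρ x = 1 - F.Gd ρ y := by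
  rw [← F.z_G_total hρ, ← intervalIntegral.integral_of_le hy, Gd, Gd,
    intervalIntegral.integral_interval_sub_left hρ.integrable.intervalIntegrable
      hρ.integrable.intervalIntegrable]

lemma z_G_inv (F : PWUnimodal 2) {ρ : ℝ → ℝ} (hρ : F.IsInvDensity ρ) {y : ℝ}
    (hy : y ∈ Icc F.a (F.f F.c)) :
    F.Gd ρ y = F.Gd ρ (F.ψP y) + (1 - F.Gd ρ (F.ψM y)) := by
  obtain ⟨g, hg, hgf, h⟩ := F.z_inv_set hρ (measurableSet_Iio (a := y))
  have hp := F.z_ψP_mem hy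
  have hm := F.z_ψM_mem hy
  rw [← F.z_G_Iio hρ hy.1, ← h, F.z_restr hρ (hg.measurable measurableSet_Iio)]
  have hset : g ⁻¹' (Iio y) ∩ Icc F.a F.b = Ico F.a (F.ψP y) ∪ Ioc (F.ψM y) F.b := by
    ext x
    constructor
    · rintro ⟨h1, hx⟩
      rw [mem_preimage, hgf hx, mem_Iio] at h1
      rcases le_total x F.c with hxc | hxc
      · left
        refine ⟨hx.1, ?_⟩
        rw [← F.z_f_ψP hy] at h1
        exact (F.mono.lt_iff_lt ⟨hx.1, hxc⟩ hp).1 h1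
      · right
        refine ⟨?_, hx.2⟩
        rw [← F.z_f_ψM hy] at h1
        exact (F.anti.lt_iff_gt ⟨hxc, hx.2⟩ hm).1 h1
    · rintro (hx | hx)
      · have hxI : x ∈ Icc F.a F.b := ⟨hx.1, (hx.2.le.trans hp.2).trans F.hcb.le⟩
        refine ⟨?_, hxI⟩
        rw [mem_preimage, hgf hxI, mem_Iio, ← F.z_f_ψP hy]
        exact F.mono ⟨hx.1, hx.2.le.trans hp.2⟩ hp hx.2
      · have hxI : x ∈ Icc F.a F.b := ⟨F.hac.le.trans (hm.1.trans hx.1.le), hx.2⟩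
        refine ⟨?_, hxI⟩
        rw [mem_preimage, hgf hxI, mem_Iio, ← F.z_f_ψM hy]
        exact F.anti hm ⟨hm.1.trans hx.1.le, hx.2⟩ hx.1
  rw [hset, setIntegral_union _ measurableSet_Ioc hρ.integrable.integrableOn
    hρ.integrable.integrableOn, F.z_G_Ioi hρ hm.2, integral_Ico_eq_integral_Ioc,
    ← intervalIntegral.integral_of_le hp.1]
  · rfl
  rw [Set.disjoint_left]
  intro x h1 h2
  linarith [h1.2, h2.1, hp.2, hm.1]

lemma z_G_top (F : PWUnimodal 2) {ρ : ℝ → ℝ} (hρ : F.IsInvDensity ρ) {y : ℝ}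
    (hy : F.f F.c ≤ y) : F.Gd ρ y = 1 := by
  rcases hy.eq_or_lt with rfl | hy
  · have hc : F.f F.c ∈ Icc F.a (F.f F.c) := ⟨(F.hac.trans F.z_c_lt).le, le_rfl⟩
    rw [F.z_G_inv hρ hc, F.z_ψP_f (right_mem_Icc.2 F.hac.le), F.z_ψM_f (left_mem_Icc.2 F.hcb.le)]
    ring
  · obtain ⟨g, hg, hgf, h⟩ := F.z_inv_set hρ (measurableSet_Iio (a := y))
    rw [← F.z_G_Iio hρ ((F.hac.trans F.z_c_lt).trans hy).le, ← h,
      F.z_restr hρ (hg.measurable measurableSet_Iio), ← F.z_mass hρ]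
    congr 2
    rw [inter_eq_right]
    intro x hx
    rw [mem_preimage, hgf hx]
    exact (F.z_f_mem hx).2.trans_lt hy

lemma z_G_right (F : PWUnimodal 2) {ρ : ℝ → ℝ} (hρ : F.IsInvDensity ρ) (y : ℝ) :
    HasDerivWithinAt (F.Gd ρ) (ρ.rightLim y) (Ici y) y :=
  intervalIntegral.integral_hasDerivWithinAt_of_tendsto_ae_right (t := Ioi y)
    hρ.integrable.intervalIntegrable
    (hρ.integrable.aestronglyMeasurable.stronglyMeasurableAtFilter)
    ((hρ.bv.tendsto_rightLim y).mono_left inf_le_left)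

lemma z_G_left (F : PWUnimodal 2) {ρ : ℝ → ℝ} (hρ : F.IsInvDensity ρ) (y : ℝ) :
    HasDerivWithinAt (F.Gd ρ) (ρ.leftLim y) (Iic y) y := by
  refine intervalIntegral.integral_hasDerivWithinAt_of_tendsto_ae_right (t := Iic y)
    hρ.integrable.intervalIntegrable
    (hρ.integrable.aestronglyMeasurable.stronglyMeasurableAtFilter)
    ((hρ.bv.tendsto_leftLim y).mono_left ?_)
  have h : ({y}ᶜ : Set ℝ) ∈ ae (volume : Measure ℝ) := by
    simp [mem_ae_iff]
  rw [← Iic_sdiff_right, sdiff_eq, nhdsWithin_inter', inf_comm, inf_comm (𝓝[≤] y)]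
  exact inf_le_inf_right _ (le_principal_iff.2 h)

/-- transfer identity, right limits -/
lemma z_R (F : PWUnimodal 2) {ρ : ℝ → ℝ} (hρ : F.IsInvDensity ρ) {y : ℝ}
    (hy : y ∈ Ico F.a (F.f F.c)) :
    ρ.rightLim y = ρ.rightLim (F.ψP y) / deriv F.fp (F.ψP y)
      - ρ.leftLim (F.ψM y) / deriv F.fm (F.ψM y) := by
  have hy' : y ∈ Icc F.a (F.f F.c) := ⟨hy.1, hy.2.le⟩
  have hsub : Ico y (F.f F.c) ⊆ Icc F.a (F.f F.c) := fun z hz => ⟨hy.1.trans hz.1, hz.2.le⟩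
  have h0 : HasDerivWithinAt (F.Gd ρ) (ρ.rightLim y) (Ico y (F.f F.c)) y :=
    (F.z_G_right hρ y).mono fun z hz => hz.1
  have h1 : HasDerivWithinAt (F.Gd ρ ∘ F.ψP) (ρ.rightLim (F.ψP y) * (deriv F.fp (F.ψP y))⁻¹)
      (Ico y (F.f F.c)) y :=
    (F.z_G_right hρ (F.ψP y)).comp y ((F.z_ψP_deriv hy').mono hsub) fun z hz =>
      F.z_ψP_mono.monotoneOn hy' (hsub hz) hz.1
  have h2 : HasDerivWithinAt (F.Gd ρ ∘ F.ψM) (ρ.leftLim (F.ψM y) * (deriv F.fm (F.ψM y))⁻¹)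
      (Ico y (F.f F.c)) y :=
    (F.z_G_left hρ (F.ψM y)).comp y ((F.z_ψM_deriv hy').mono hsub) fun z hz =>
      F.z_ψM_anti.antitoneOn hy' (hsub hz) hz.1
  have h3 := (h1.add (h2.const_sub 1)).congr (f₁ := F.Gd ρ)
    (fun z hz => F.z_G_inv hρ (hsub hz)) (F.z_G_inv hρ hy')
  have := (uniqueDiffOn_Ico y (F.f F.c) y (left_mem_Ico.2 hy.2)).eq_deriv _ h0 h3
  rw [this, div_eq_mul_inv, div_eq_mul_inv]; ring

/-- transfer identity, left limits -/
lemma z_L0 (F : PWUnimodal 2) {ρ : ℝ → ℝ} (hρ : F.IsInvDensity ρ) {y : ℝ}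
    (hy : y ∈ Ioc F.a (F.f F.c)) :
    ρ.leftLim y = ρ.leftLim (F.ψP y) / deriv F.fp (F.ψP y)
      - ρ.rightLim (F.ψM y) / deriv F.fm (F.ψM y) := by
  have hy' : y ∈ Icc F.a (F.f F.c) := ⟨hy.1.le, hy.2⟩
  have hsub : Ioc F.a y ⊆ Icc F.a (F.f F.c) := fun z hz => ⟨hz.1.le, hz.2.trans hy.2⟩
  have h0 : HasDerivWithinAt (F.Gd ρ) (ρ.leftLim y) (Ioc F.a y) y :=
    (F.z_G_left hρ y).mono fun z hz => hz.2
  have h1 : HasDerivWithinAt (F.Gd ρ ∘ F.ψP) (ρ.leftLim (F.ψP y) * (deriv F.fp (F.ψP y))⁻¹)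
      (Ioc F.a y) y :=
    (F.z_G_left hρ (F.ψP y)).comp y ((F.z_ψP_deriv hy').mono hsub) fun z hz =>
      F.z_ψP_mono.monotoneOn (hsub hz) hy' hz.2
  have h2 : HasDerivWithinAt (F.Gd ρ ∘ F.ψM) (ρ.rightLim (F.ψM y) * (deriv F.fm (F.ψM y))⁻¹)
      (Ioc F.a y) y :=
    (F.z_G_right hρ (F.ψM y)).comp y ((F.z_ψM_deriv hy').mono hsub) fun z hz =>
      F.z_ψM_anti.antitoneOn (hsub hz) hy' hz.2
  have h3 := (h1.add (h2.const_sub 1)).congr (f₁ := F.Gd ρ)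
    (fun z hz => F.z_G_inv hρ (hsub hz)) (F.z_G_inv hρ hy')
  have := (uniqueDiffOn_Ioc F.a y y (right_mem_Ioc.2 hy.1)).eq_deriv _ h0 h3
  rw [this, div_eq_mul_inv, div_eq_mul_inv]; ring

lemma z_R_nonneg (F : PWUnimodal 2) {ρ : ℝ → ℝ} (hρ : F.IsInvDensity ρ) (y : ℝ) :
    0 ≤ ρ.rightLim y :=
  ge_of_tendsto' (hρ.bv.tendsto_rightLim y) fun x => hρ.nonneg x

lemma z_L_nonneg (F : PWUnimodal 2) {ρ : ℝ → ℝ} (hρ : F.IsInvDensity ρ) (y : ℝ) :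
    0 ≤ ρ.leftLim y :=
  ge_of_tendsto' (hρ.bv.tendsto_leftLim y) fun x => hρ.nonneg x

lemma z_R_top (F : PWUnimodal 2) {ρ : ℝ → ℝ} (hρ : F.IsInvDensity ρ) {y : ℝ}
    (hy : F.f F.c ≤ y) : ρ.rightLim y = 0 := by
  have h1 : HasDerivWithinAt (F.Gd ρ) 0 (Ici y) y :=
    (hasDerivWithinAt_const y (Ici y) (1 : ℝ)).congr
      (fun z hz => F.z_G_top hρ (hy.trans hz)) (F.z_G_top hρ hy)
  exact (uniqueDiffOn_Ici y y self_mem_Ici).eq_deriv _ (F.z_G_right hρ y) h1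

lemma z_L_top (F : PWUnimodal 2) {ρ : ℝ → ℝ} (hρ : F.IsInvDensity ρ) {y : ℝ}
    (hy : F.f F.c < y) : ρ.leftLim y = 0 := by
  have h1 : HasDerivWithinAt (F.Gd ρ) 0 (Ioc (F.f F.c) y) y :=
    (hasDerivWithinAt_const y _ (1 : ℝ)).congr
      (fun z hz => F.z_G_top hρ hz.1.le) (F.z_G_top hρ hy.le)
  exact (uniqueDiffOn_Ioc (F.f F.c) y y (right_mem_Ioc.2 hy)).eq_deriv _
    ((F.z_G_left hρ y).mono fun z hz => hz.2) h1

lemma z_L_bot (F : PWUnimodal 2) {ρ : ℝ → ℝ} (hρ : F.IsInvDensity ρ) {y : ℝ}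
    (hy : y ≤ F.a) : ρ.leftLim y = 0 := by
  refine tendsto_nhds_unique (hρ.bv.tendsto_leftLim y) (tendsto_const_nhds.congr' ?_)
  filter_upwards [self_mem_nhdsWithin] with z hz
  by_contra h
  have hz' : z < y := hz
  linarith [(hρ.supp (Ne.symm h)).1]

lemma z_R_bot (F : PWUnimodal 2) {ρ : ℝ → ℝ} (hρ : F.IsInvDensity ρ) {y : ℝ}
    (hy : y < F.a) : ρ.rightLim y = 0 := by
  refine tendsto_nhds_unique (hρ.bv.tendsto_rightLim y) (tendsto_const_nhds.congr' ?_)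
  filter_upwards [Ioo_mem_nhdsGT hy] with z hz
  by_contra h
  linarith [(hρ.supp (Ne.symm h)).1, hz.2]

lemma z_L (F : PWUnimodal 2) {ρ : ℝ → ℝ} (hρ : F.IsInvDensity ρ) {y : ℝ}
    (hy : y ∈ Icc F.a (F.f F.c)) :
    ρ.leftLim y = ρ.leftLim (F.ψP y) / deriv F.fp (F.ψP y)
      - ρ.rightLim (F.ψM y) / deriv F.fm (F.ψM y) := by
  rcases hy.1.eq_or_lt with h | h
  · rw [F.z_L_bot hρ h.ge]
    have hp : F.ψP y = F.a := by
      rw [← h]; nth_rw 1 [← F.fa]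
      exact F.z_ψP_f (left_mem_Icc.2 F.hac.le)
    have hm : F.ψM y = F.b := by
      rw [← h]; nth_rw 1 [← F.fb]
      exact F.z_ψM_f (right_mem_Icc.2 F.hcb.le)
    rw [hp, hm, F.z_L_bot hρ le_rfl, F.z_R_top hρ F.z_c1_le]
    simp
  · exact F.z_L0 hρ ⟨h, hy.2⟩

/-- The jump of a function at a point. -/
def jmp (ρ : ℝ → ℝ) (y : ℝ) : ℝ := ρ.rightLim y - ρ.leftLim y

lemma z_jmp_out (F : PWUnimodal 2) {ρ : ℝ → ℝ} (hρ : F.IsInvDensity ρ) {y : ℝ}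
    (hy : y ∉ Icc F.a (F.f F.c)) : jmp ρ y = 0 := by
  by_cases h : y < F.a
  · rw [jmp, F.z_R_bot hρ h, F.z_L_bot hρ h.le, sub_zero]
  · have h' : F.f F.c < y := by
      by_contra hc
      exact hy ⟨not_lt.1 h, not_lt.1 hc⟩
    rw [jmp, F.z_R_top hρ h'.le, F.z_L_top hρ h', sub_zero]

lemma z_ψP_lt (F : PWUnimodal 2) {y : ℝ} (hy : y ∈ Ico F.a (F.f F.c)) : F.ψP y < F.c := by
  have hy' : y ∈ Icc F.a (F.f F.c) := ⟨hy.1, hy.2.le⟩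
  refine lt_of_le_of_ne (F.z_ψP_mem hy').2 fun h => ?_
  have := F.z_f_ψP hy'
  rw [h] at this
  linarith [hy.2]

lemma z_ψM_gt (F : PWUnimodal 2) {y : ℝ} (hy : y ∈ Ico F.a (F.f F.c)) : F.c < F.ψM y := by
  have hy' : y ∈ Icc F.a (F.f F.c) := ⟨hy.1, hy.2.le⟩
  refine lt_of_le_of_ne (F.z_ψM_mem hy').1 fun h => ?_
  have := F.z_f_ψM hy'
  rw [← h] at this
  linarith [hy.2]

lemma z_jmp (F : PWUnimodal 2) {ρ : ℝ → ℝ} (hρ : F.IsInvDensity ρ) {y : ℝ}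
    (hy : y ∈ Ico F.a (F.f F.c)) :
    jmp ρ y = jmp ρ (F.ψP y) / F.d (F.ψP y) + jmp ρ (F.ψM y) / F.d (F.ψM y) := by
  rw [jmp, F.z_R hρ hy, F.z_L hρ ⟨hy.1, hy.2.le⟩, jmp, jmp, d, d, if_pos (F.z_ψP_lt hy).le,
    if_neg (F.z_ψM_gt hy).not_ge]
  ring

lemma z_jmp_c1 (F : PWUnimodal 2) {ρ : ℝ → ℝ} (hρ : F.IsInvDensity ρ)
    (h : jmp ρ (F.f F.c) = 0) : ρ.rightLim F.c = 0 ∧ ρ.leftLim F.c = 0 := by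
  have hc : F.f F.c ∈ Icc F.a (F.f F.c) := ⟨(F.hac.trans F.z_c_lt).le, le_rfl⟩
  rw [jmp, F.z_R_top hρ le_rfl, F.z_L hρ hc, F.z_ψP_f (right_mem_Icc.2 F.hac.le),
    F.z_ψM_f (left_mem_Icc.2 F.hcb.le)] at h
  have h1 := F.z_dp (right_mem_Icc.2 F.hac.le)
  have h2 := F.z_dm (left_mem_Icc.2 F.hcb.le)
  have hκ := F.one_lt_κ
  have h3 : 0 ≤ ρ.leftLim F.c / deriv F.fp F.c :=
    div_nonneg (F.z_L_nonneg hρ _) (by linarith)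
  have h4 : ρ.rightLim F.c / deriv F.fm F.c ≤ 0 :=
    div_nonpos_of_nonneg_of_nonpos (F.z_R_nonneg hρ _) (by linarith)
  have h5 : ρ.leftLim F.c / deriv F.fp F.c = 0 := by linarith
  have h6 : ρ.rightLim F.c / deriv F.fm F.c = 0 := by linarith
  rw [div_eq_zero_iff] at h5 h6
  constructor
  · rcases h6 with h | h
    · exact h
    · linarith
  · rcases h5 with h | h
    · exact h
    · linarith

/-- If the density has no jump at all then we get a contradiction. -/
lemma z_no_jump (F : PWUnimodal 2) {ρ : ℝ → ℝ} (hρ : F.IsInvDensity ρ)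
    (h : ∀ y, jmp ρ y = 0) : False := by
  have hab : F.a < F.b := F.hac.trans F.hcb
  have hκ := F.one_lt_κ
  have hc0 := (F.z_jmp_c1 hρ (h _)).1
  have heq : ∀ y, ρ.rightLim y = ρ.leftLim y := fun y => sub_eq_zero.1 (h y)
  have hin : ∀ x, 0 < ρ.rightLim x → x ∈ Icc F.a F.b := by
    intro x hx
    by_contra hc
    by_cases h1 : x < F.a
    · rw [F.z_R_bot hρ h1] at hx; exact lt_irrefl _ hx
    · have : F.b < x := by
        by_contra h2
        exact hc ⟨not_lt.1 h1, not_lt.1 h2⟩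
      rw [F.z_R_top hρ (F.z_c1_le.trans this.le)] at hx
      exact lt_irrefl _ hx
  have hne : ∀ x, 0 < ρ.rightLim x → x ≠ F.c := by
    rintro x hx rfl
    linarith
  -- forward invariance of the positivity set
  have hfwd : ∀ x, 0 < ρ.rightLim x → 0 < ρ.rightLim (F.f x) := by
    intro x hx
    have hxI := hin x hx
    have hxc := hne x hx
    have hfx : F.f x ∈ Ico F.a (F.f F.c) := ⟨(F.z_f_mem hxI).1, F.z_lt_c1 hxI hxc⟩
    have hfx' : F.f x ∈ Icc F.a (F.f F.c) := ⟨hfx.1, hfx.2.le⟩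
    have d1 := F.z_dp (F.z_ψP_mem hfx')
    have d2 := F.z_dm (F.z_ψM_mem hfx')
    have t1 : 0 ≤ ρ.rightLim (F.ψP (F.f x)) / deriv F.fp (F.ψP (F.f x)) :=
      div_nonneg (F.z_R_nonneg hρ _) (by linarith)
    have t2 : ρ.leftLim (F.ψM (F.f x)) / deriv F.fm (F.ψM (F.f x)) ≤ 0 :=
      div_nonpos_of_nonneg_of_nonpos (F.z_L_nonneg hρ _) (by linarith)
    rw [F.z_R hρ hfx]
    rcases lt_or_gt_of_ne hxc with hlt | hgt
    · have e : F.ψP (F.f x) = x := F.z_ψP_f ⟨hxI.1, hlt.le⟩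
      have : 0 < ρ.rightLim (F.ψP (F.f x)) / deriv F.fp (F.ψP (F.f x)) :=
        div_pos (by rwa [e]) (by linarith)
      linarith
    · have e : F.ψM (F.f x) = x := F.z_ψM_f ⟨hgt.le, hxI.2⟩
      have : ρ.leftLim (F.ψM (F.f x)) / deriv F.fm (F.ψM (F.f x)) < 0 :=
        div_neg_of_pos_of_neg (by rwa [e, ← heq]) (by linarith)
      linarith
  -- a point of positivity
  obtain ⟨x0, hx0⟩ : ∃ x0, 0 < ρ.rightLim x0 := by
    by_contra hc
    push Not at hc
    have hz : ∀ x, ρ.rightLim x = 0 := fun x => le_antisymm (hc x) (F.z_R_nonneg hρ x)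
    have hcont : ContinuousOn (F.Gd ρ) (Icc F.a F.b) := by
      intro x hx
      have := ((F.z_G_right hρ x).continuousWithinAt).union ((F.z_G_left hρ x).continuousWithinAt)
      exact this.mono fun z _ => (le_total x z)
    have := constant_of_has_deriv_right_zero hcont
      (fun x _ => by simpa [hz x] using F.z_G_right hρ x) F.b (right_mem_Icc.2 hab.le)
    rw [F.z_G_total hρ, Gd, intervalIntegral.integral_same] at this
    exact one_ne_zero this
  -- an interval of positivity
  obtain ⟨u0, v0, huv0, hpos0⟩ : ∃ u v, u < v ∧ ∀ x ∈ Icc u v, 0 < ρ.rightLim x := by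
    have hev := (hρ.bv.tendsto_rightLim x0).eventually (lt_mem_nhds (half_lt_self hx0))
    obtain ⟨w, hw, hsub⟩ := mem_nhdsGT_iff_exists_Ioo_subset.1 hev
    have hw' : x0 < w := hw
    refine ⟨(2 * x0 + w) / 3, (x0 + 2 * w) / 3, by linarith, fun x hx => ?_⟩
    have : ρ.rightLim x0 / 2 ≤ ρ.rightLim x := by
      refine ge_of_tendsto (hρ.bv.tendsto_rightLim x) ?_
      have hxw : x < w := by linarith [hx.2]
      filter_upwards [Ioo_mem_nhdsGT hxw] with z hz
      exact (hsub ⟨by linarith [hx.1, hz.1], hz.2⟩ : _).le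
    linarith
  have hgrow : ∀ n : ℕ, ∃ u v, F.κ ^ n * (v0 - u0) ≤ v - u ∧ u < v ∧
      ∀ x ∈ Icc u v, 0 < ρ.rightLim x := by
    intro n
    induction n with
    | zero => exact ⟨u0, v0, by simp, huv0, hpos0⟩
    | succ n ih =>
      obtain ⟨u, v, h1, h2, h3⟩ := ih
      have hu := hin u (h3 u (left_mem_Icc.2 h2.le))
      have hv := hin v (h3 v (right_mem_Icc.2 h2.le))
      have hcn : F.c ∉ Icc u v := fun hc => hne _ (h3 _ hc) rfl
      have hcont : ContinuousOn F.f (Icc u v) := F.cont.mono (Icc_subset_Icc hu.1 hv.2)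
      have hk : F.κ ^ (n + 1) * (v0 - u0) ≤ F.κ * (v - u) := by
        rw [pow_succ']; nlinarith
      have hpos : 0 < F.κ * (v - u) := by nlinarith
      by_cases hvc : v ≤ F.c
      · have he := F.z_exp_p ⟨hu.1, h2.le.trans hvc⟩ ⟨hv.1, hvc⟩ h2.le
        refine ⟨F.f u, F.f v, by linarith, by linarith, fun x hx => ?_⟩
        obtain ⟨z, hz, rfl⟩ := intermediate_value_Icc h2.le hcont hx
        exact hfwd z (h3 z hz)
      · have huc : F.c ≤ u := by
          by_contra hc
          exact hcn ⟨(not_le.1 hc).le, (not_le.1 hvc).le⟩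
        have he := F.z_exp_m ⟨huc, hu.2⟩ ⟨huc.trans h2.le, hv.2⟩ h2.le
        refine ⟨F.f v, F.f u, by linarith, by linarith, fun x hx => ?_⟩
        obtain ⟨z, hz, rfl⟩ := intermediate_value_Icc' h2.le hcont hx
        exact hfwd z (h3 z hz)
  obtain ⟨n, hn⟩ := pow_unbounded_of_one_lt ((F.b - F.a) / (v0 - u0)) hκ
  obtain ⟨u, v, h1, h2, h3⟩ := hgrow n
  have hu := hin u (h3 u (left_mem_Icc.2 h2.le))
  have hv := hin v (h3 v (right_mem_Icc.2 h2.le))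
  rw [div_lt_iff₀ (by linarith)] at hn
  linarith [hu.1, hv.2]

end PWUnimodal

namespace PWUnimodal

/-! ### Jumps of the saltus part -/

open scoped Classical in
/-- The weights, cut off beyond `N_f`. -/
def wt (F : PWUnimodal 2) (s : ℕ → ℝ) (n : ℕ) : ℝ :=
  if 1 ≤ n ∧ (n : ℕ∞) ≤ F.Nf then s n else 0

/-- Summability of the saltus series at `x`. -/
def Sm (F : PWUnimodal 2) (s : ℕ → ℝ) (x : ℝ) : Prop :=
  Summable (fun n => F.wt s n * Hfun (F.ck n) x)

lemma z_saltus (F : PWUnimodal 2) (s : ℕ → ℝ) (x : ℝ) :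
    F.saltus s x = ∑' n, F.wt s n * Hfun (F.ck n) x := by
  unfold saltus sumTo
  refine tsum_congr fun n => ?_
  unfold wt
  split_ifs <;> simp

lemma z_H_abs {u x x' : ℝ} (h : x ≤ x') : |Hfun u x'| ≤ |Hfun u x| := by
  unfold Hfun
  split_ifs <;> norm_num <;> grind

lemma z_H_abs_one (u x : ℝ) : |Hfun u x| ≤ 1 := by
  unfold Hfun
  split_ifs <;> norm_num

lemma z_Sm_mono (F : PWUnimodal 2) (s : ℕ → ℝ) {x x' : ℝ} (h : x ≤ x') (hx : F.Sm s x) :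
    F.Sm s x' := by
  refine Summable.of_norm_bounded hx.abs fun n => ?_
  rw [Real.norm_eq_abs, abs_mul, abs_mul]
  exact mul_le_mul_of_nonneg_left (z_H_abs h) (abs_nonneg _)

lemma z_H_right (u y : ℝ) : ∀ᶠ x in 𝓝[>] y, Hfun u x = if y < u then -1 else 0 := by
  split_ifs with h
  · filter_upwards [Ioo_mem_nhdsGT h] with x hx
    simp [Hfun, hx.2]
  · filter_upwards [self_mem_nhdsWithin] with x hx
    have hx' : y < x := hx
    have h1 : ¬ x < u := by linarith [not_lt.1 h]
    have h2 : x ≠ u := by linarith [not_lt.1 h]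
    simp [Hfun, h1, h2]

lemma z_H_left (u y : ℝ) : ∀ᶠ x in 𝓝[<] y, Hfun u x = if y ≤ u then -1 else 0 := by
  split_ifs with h
  · filter_upwards [self_mem_nhdsWithin] with x hx
    have hx' : x < y := hx
    simp [Hfun, hx'.trans_le h]
  · filter_upwards [Ioo_mem_nhdsLT (not_le.1 h)] with x hx
    have h1 : ¬ x < u := not_lt.2 hx.1.le
    have h2 : x ≠ u := hx.1.ne'
    simp [Hfun, h1, h2]

lemma z_jmp_reg {ρ₀ ρreg g : ℝ → ℝ} (hbv : BoundedVariationOn ρ₀ univ) (hc : Continuous ρreg)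
    (heq : ∀ x, ρ₀ x = ρreg x + g x) {y r l : ℝ} (hr : Tendsto g (𝓝[>] y) (𝓝 r))
    (hl : Tendsto g (𝓝[<] y) (𝓝 l)) : jmp ρ₀ y = r - l := by
  have e : ρ₀ = fun x => ρreg x + g x := funext heq
  have h1 : Tendsto ρ₀ (𝓝[>] y) (𝓝 (ρreg y + r)) := by
    rw [e]; exact (hc.continuousAt.mono_left inf_le_left).add hr
  have h2 : Tendsto ρ₀ (𝓝[<] y) (𝓝 (ρreg y + l)) := by
    rw [e]; exact (hc.continuousAt.mono_left inf_le_left).add hl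
  rw [jmp, tendsto_nhds_unique (hbv.tendsto_rightLim y) h1,
    tendsto_nhds_unique (hbv.tendsto_leftLim y) h2]
  ring

open scoped Classical in
lemma z_jmp_A (F : PWUnimodal 2) {ρ₀ ρreg : ℝ → ℝ} {s : ℕ → ℝ} (hρ : F.IsInvDensity ρ₀)
    (hdec : F.SaltusDecomp ρ₀ ρreg s) {x0 y : ℝ} (hxy : x0 < y) (hS : F.Sm s x0) :
    jmp ρ₀ y = ∑' n, if F.ck n = y then F.wt s n else 0 := by
  have heq : ∀ x, ρ₀ x = ρreg x + ∑' n, F.wt s n * Hfun (F.ck n) x := fun x => by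
    rw [hdec.eq x, z_saltus]
  have hr : Tendsto (fun x => ∑' n, F.wt s n * Hfun (F.ck n) x) (𝓝[>] y)
      (𝓝 (∑' n, F.wt s n * (if y < F.ck n then -1 else 0))) := by
    refine tendsto_tsum_of_dominated_convergence hS.abs (fun n => ?_) ?_
    · exact tendsto_const_nhds.congr' ((z_H_right (F.ck n) y).mono fun x hx => by simp only [hx])
    · filter_upwards [self_mem_nhdsWithin] with x hx n
      rw [Real.norm_eq_abs, abs_mul, abs_mul]
      exact mul_le_mul_of_nonneg_left (z_H_abs (hxy.le.trans (le_of_lt hx))) (abs_nonneg _)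
  have hl : Tendsto (fun x => ∑' n, F.wt s n * Hfun (F.ck n) x) (𝓝[<] y)
      (𝓝 (∑' n, F.wt s n * (if y ≤ F.ck n then -1 else 0))) := by
    refine tendsto_tsum_of_dominated_convergence hS.abs (fun n => ?_) ?_
    · exact tendsto_const_nhds.congr' ((z_H_left (F.ck n) y).mono fun x hx => by simp only [hx])
    · filter_upwards [Ioo_mem_nhdsLT hxy] with x hx n
      rw [Real.norm_eq_abs, abs_mul, abs_mul]
      exact mul_le_mul_of_nonneg_left (z_H_abs hx.1.le) (abs_nonneg _)
  rw [z_jmp_reg hρ.bv hdec.cont heq hr hl, ← Summable.tsum_sub]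
  · refine tsum_congr fun n => ?_
    rcases lt_trichotomy (F.ck n) y with h | h | h
    · simp [h.ne, h.not_ge, h.not_gt]
    · simp [h]
    · simp [h, h.ne', h.le]
  · refine Summable.of_norm_bounded hS.abs fun n => ?_
    rw [Real.norm_eq_abs, abs_mul, abs_mul]
    refine mul_le_mul_of_nonneg_left ?_ (abs_nonneg _)
    split_ifs with h
    · simp [Hfun, hxy.trans h]
    · simp
  · refine Summable.of_norm_bounded hS.abs fun n => ?_
    rw [Real.norm_eq_abs, abs_mul, abs_mul]
    refine mul_le_mul_of_nonneg_left ?_ (abs_nonneg _)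
    split_ifs with h
    · simp [Hfun, hxy.trans_le h]
    · simp

lemma z_jmp_B (F : PWUnimodal 2) {ρ₀ ρreg : ℝ → ℝ} {s : ℕ → ℝ} (hρ : F.IsInvDensity ρ₀)
    (hdec : F.SaltusDecomp ρ₀ ρreg s) {x0 y : ℝ} (hxy : y < x0) (hS : ¬ F.Sm s x0) :
    jmp ρ₀ y = 0 := by
  have heq : ∀ x, ρ₀ x = ρreg x + ∑' n, F.wt s n * Hfun (F.ck n) x := fun x => by
    rw [hdec.eq x, z_saltus]
  have h0 : ∀ x, x < x0 → ∑' n, F.wt s n * Hfun (F.ck n) x = 0 := fun x hx =>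
    tsum_eq_zero_of_not_summable fun h => hS (F.z_Sm_mono s hx.le h)
  have hr : Tendsto (fun x => ∑' n, F.wt s n * Hfun (F.ck n) x) (𝓝[>] y) (𝓝 0) := by
    refine tendsto_const_nhds.congr' ?_
    filter_upwards [Ioo_mem_nhdsGT hxy] with x hx
    rw [h0 x hx.2]
  have hl : Tendsto (fun x => ∑' n, F.wt s n * Hfun (F.ck n) x) (𝓝[<] y) (𝓝 0) := by
    refine tendsto_const_nhds.congr' ?_
    filter_upwards [self_mem_nhdsWithin] with x hx
    rw [h0 x (lt_trans hx hxy)]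
  rw [z_jmp_reg hρ.bv hdec.cont heq hr hl, sub_zero]

/-! ### The postcritical orbit -/

lemma z_ck_succ (F : PWUnimodal 2) (n : ℕ) : F.ck (n + 1) = F.f (F.ck n) := by
  simp only [ck, Function.iterate_succ_apply']

lemma z_ck_mem (F : PWUnimodal 2) (n : ℕ) : F.ck n ∈ Icc F.a F.b := by
  induction n with
  | zero => exact F.z_c_mem
  | succ n ih => rw [z_ck_succ]; exact F.mapsI ih

lemma z_ck_add (F : PWUnimodal 2) (n m : ℕ) : F.f^[m] (F.ck n) = F.ck (m + n) := by
  simp only [ck, Function.iterate_add_apply]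

lemma z_d_abs (F : PWUnimodal 2) {x : ℝ} (hx : x ∈ Icc F.a F.b) : F.κ ≤ |F.d x| := by
  unfold d
  split_ifs with h
  · exact F.fp_exp x (F.subUp ⟨hx.1, h⟩)
  · exact F.fm_exp x (F.subUm ⟨(not_le.1 h).le, hx.2⟩)

lemma z_d_ne (F : PWUnimodal 2) {x : ℝ} (hx : x ∈ Icc F.a F.b) : F.d x ≠ 0 := by
  intro h
  have := F.z_d_abs hx
  rw [h, abs_zero] at this
  linarith [F.one_lt_κ]

lemma z_dn_succ (F : PWUnimodal 2) (n : ℕ) (x : ℝ) :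
    F.dn (n + 1) x = F.dn n x * F.d (F.f^[n] x) := by
  simp only [dn, Finset.prod_range_succ]

lemma z_dn_abs (F : PWUnimodal 2) {x : ℝ} (hx : x ∈ Icc F.a F.b) (n : ℕ) :
    F.κ ^ n ≤ |F.dn n x| := by
  have hmem : ∀ n, F.f^[n] x ∈ Icc F.a F.b := fun n => F.mapsI.iterate n hx
  have hκ := F.one_lt_κ
  induction n with
  | zero => simp [dn]
  | succ n ih =>
    rw [z_dn_succ, abs_mul, pow_succ]
    exact mul_le_mul ih (F.z_d_abs (hmem n)) (by linarith) (abs_nonneg _)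

/-- The two-preimage recurrence for the jumps. -/
lemma z_rec (F : PWUnimodal 2) {ρ : ℝ → ℝ} (hρ : F.IsInvDensity ρ) {x : ℝ}
    (hx : x ∈ Icc F.a F.b) (hxc : x ≠ F.c) :
    ∃ x' ∈ Icc F.a F.b, x' ≠ x ∧ F.f x' = F.f x ∧
      jmp ρ (F.f x) = jmp ρ x / F.d x + jmp ρ x' / F.d x' := by
  have hfx : F.f x ∈ Ico F.a (F.f F.c) := ⟨(F.z_f_mem hx).1, F.z_lt_c1 hx hxc⟩
  have hfx' : F.f x ∈ Icc F.a (F.f F.c) := ⟨hfx.1, hfx.2.le⟩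
  have hp := F.z_ψP_lt hfx
  have hm := F.z_ψM_gt hfx
  have hj := F.z_jmp hρ hfx
  rcases lt_or_gt_of_ne hxc with h | h
  · refine ⟨F.ψM (F.f x), ⟨(F.hac.trans hm).le, (F.z_ψM_mem hfx').2⟩, (h.trans hm).ne',
      F.z_f_ψM hfx', ?_⟩
    rw [F.z_ψP_f ⟨hx.1, h.le⟩] at hj
    exact hj
  · refine ⟨F.ψP (F.f x), ⟨(F.z_ψP_mem hfx').1, (hp.trans F.hcb).le⟩, (hp.trans h).ne,
      F.z_f_ψP hfx', ?_⟩
    rw [F.z_ψM_f ⟨h.le, hx.2⟩] at hj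
    rw [hj]; ring

/-- The active indices. -/
def Act (F : PWUnimodal 2) (n : ℕ) : Prop := 1 ≤ n ∧ (n : ℕ∞) ≤ F.Nf

lemma z_wt_of (F : PWUnimodal 2) (s : ℕ → ℝ) {n : ℕ} (h : F.Act n) : F.wt s n = s n := if_pos h

lemma z_wt_of_not (F : PWUnimodal 2) (s : ℕ → ℝ) {n : ℕ} (h : ¬ F.Act n) : F.wt s n = 0 :=
  if_neg h

lemma z_per_of_eq (F : PWUnimodal 2) {n m : ℕ} (h : n < m) (he : F.ck n = F.ck m) :
    F.ck n ∈ Function.periodicPts F.f := by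
  refine ⟨m - n, by omega, ?_⟩
  change F.f^[m - n] (F.ck n) = F.ck n
  rw [z_ck_add, Nat.sub_add_cancel h.le, he]

open scoped Classical in
lemma z_act_inj_lt (F : PWUnimodal 2) {n m : ℕ} (hn : F.Act n) (hm : F.Act m) (h : n < m)
    (he : F.ck n = F.ck m) : False := by
  have hper := F.z_per_of_eq h he
  obtain ⟨hn1, -⟩ := hn
  obtain ⟨hm1, hm2⟩ := hm
  unfold Nf at hm2
  split_ifs at hm2 with h1 h2
  · have hm3 : m ≤ Function.minimalPeriod F.f F.c := by exact_mod_cast hm2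
    rcases hm3.eq_or_lt with h3 | h3
    · have hp : F.ck m = F.ck 0 := by
        rw [h3]; exact Function.iterate_minimalPeriod
      rw [hp] at he
      have := Function.iterate_injOn_Iio_minimalPeriod (f := F.f) (x := F.c)
        (show n ∈ Iio _ from by rw [mem_Iio]; omega) (show 0 ∈ Iio _ from by rw [mem_Iio]; omega) he
      omega
    · have := Function.iterate_injOn_Iio_minimalPeriod (f := F.f) (x := F.c)
        (show n ∈ Iio _ from by rw [mem_Iio]; omega) (show m ∈ Iio _ from h3) he
      omega
  · have hm3 : m ≤ Nat.find h2 + Function.minimalPeriod F.f (F.f^[Nat.find h2] F.c) - 1 := by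
      exact_mod_cast hm2
    have hge : Nat.find h2 ≤ n := Nat.find_min' h2 ⟨hn1, hper⟩
    generalize hN : Nat.find h2 = N at *
    have e1 : F.ck n = F.f^[n - N] (F.f^[N] F.c) := by
      rw [← Function.iterate_add_apply, Nat.sub_add_cancel hge]; rfl
    have e2 : F.ck m = F.f^[m - N] (F.f^[N] F.c) := by
      rw [← Function.iterate_add_apply, Nat.sub_add_cancel (by omega)]; rfl
    rw [e1, e2] at he
    have := Function.iterate_injOn_Iio_minimalPeriod (f := F.f) (x := F.f^[N] F.c)
        (show n - N ∈ Iio _ from by rw [mem_Iio]; omega)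
        (show m - N ∈ Iio _ from by rw [mem_Iio]; omega) he
    omega
  · exact h2 ⟨n, hn1, hper⟩

lemma z_act_inj (F : PWUnimodal 2) {n m : ℕ} (hn : F.Act n) (hm : F.Act m)
    (he : F.ck n = F.ck m) : n = m := by
  rcases lt_trichotomy n m with h | h | h
  · exact (F.z_act_inj_lt hn hm h he).elim
  · exact h
  · exact (F.z_act_inj_lt hm hn h he.symm).elim

open scoped Classical in
lemma z_tsum_act (F : PWUnimodal 2) (s : ℕ → ℝ) {n : ℕ} (hn : F.Act n) :
    (∑' k, if F.ck k = F.ck n then F.wt s k else 0) = s n := by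
  rw [tsum_eq_single n]
  · rw [if_pos rfl, F.z_wt_of s hn]
  · intro k hk
    split_ifs with h
    · exact F.z_wt_of_not s fun hk' => hk (F.z_act_inj hk' hn h)
    · rfl

open scoped Classical in
lemma z_tsum_off (F : PWUnimodal 2) (s : ℕ → ℝ) {y : ℝ} (hy : ∀ n, F.Act n → F.ck n ≠ y) :
    (∑' k, if F.ck k = y then F.wt s k else 0) = 0 := by
  have : (fun k => if F.ck k = y then F.wt s k else 0) = fun _ => 0 := by
    funext k
    split_ifs with h
    · exact F.z_wt_of_not s fun hk' => hy k hk' h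
    · rfl
  rw [this, tsum_zero]

lemma z_Sm_fin (F : PWUnimodal 2) (s : ℕ → ℝ) {N : ℕ} (hN : F.Nf = N) (x : ℝ) : F.Sm s x := by
  refine summable_of_ne_finset_zero (s := Finset.range (N + 1)) fun n hn => ?_
  rw [F.z_wt_of_not s, zero_mul]
  rintro ⟨_, h⟩
  rw [hN] at h
  have : n ≤ N := by exact_mod_cast h
  exact hn (Finset.mem_range.2 (by omega))

lemma z_inf (F : PWUnimodal 2) (h : F.Nf = ⊤) {m : ℕ} (hm : 0 < m) :
    F.ck m ∉ Function.periodicPts F.f := by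
  unfold Nf at h
  split_ifs at h with h1 h2
  · exact (ENat.natCast_ne_top _ h).elim
  · exact (ENat.natCast_ne_top _ h).elim
  · exact fun hp => h2 ⟨m, hm, hp⟩

lemma z_inf_act (F : PWUnimodal 2) (h : F.Nf = ⊤) {m : ℕ} (hm : 1 ≤ m) : F.Act m :=
  ⟨hm, by rw [h]; exact le_top⟩

lemma z_inf_ne (F : PWUnimodal 2) (h : F.Nf = ⊤) {m : ℕ} (hm : 1 ≤ m) : F.ck m ≠ F.c := by
  intro hc
  have h1 := F.z_inf h hm
  have h2 : F.ck 0 = F.ck m := by rw [hc]; rfl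
  have := F.z_per_of_eq hm h2
  rw [h2] at this
  exact h1 this

/-- In the infinite case: zero jumps off the orbit. -/
lemma z_inf_off (F : PWUnimodal 2) {ρ₀ ρreg : ℝ → ℝ} {s : ℕ → ℝ} (hρ : F.IsInvDensity ρ₀)
    (hdec : F.SaltusDecomp ρ₀ ρreg s) {xs : ℝ}
    (hA : ∀ y, xs < y → ∃ x0 < y, F.Sm s x0) (hB : ∀ y, y < xs → ∃ x0 > y, ¬ F.Sm s x0)
    {y : ℝ} (hy : ∀ n, F.Act n → F.ck n ≠ y) (hinf : F.Nf = ⊤) : jmp ρ₀ y = 0 := by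
  have hne : ∀ y, y ≠ xs → (∀ n, F.Act n → F.ck n ≠ y) → jmp ρ₀ y = 0 := by
    intro y hyx hy
    rcases lt_or_gt_of_ne hyx with h | h
    · obtain ⟨x0, hx0, hS⟩ := hB y h
      exact F.z_jmp_B hρ hdec hx0 hS
    · obtain ⟨x0, hx0, hS⟩ := hA y h
      rw [F.z_jmp_A hρ hdec hx0 hS, F.z_tsum_off s hy]
  by_cases hyx : y = xs
  swap
  · exact hne y hyx hy
  by_cases hyI : y ∈ Icc F.a (F.f F.c)
  swap
  · exact F.z_jmp_out hρ hyI
  have hyc1 : y ≠ F.f F.c := fun h => hy 1 (F.z_inf_act hinf le_rfl) (by rw [h]; rfl)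
  have hyI' : y ∈ Ico F.a (F.f F.c) := ⟨hyI.1, lt_of_le_of_ne hyI.2 hyc1⟩
  have hyII : y ∈ Icc F.a F.b := ⟨hyI.1, hyI.2.trans F.z_c1_le⟩
  have hpre : ∀ x, F.f x = y → ∀ n, F.Act n → F.ck n ≠ x := by
    intro x hx n hn hc
    refine hy (n + 1) (F.z_inf_act hinf (by omega)) ?_
    rw [z_ck_succ, hc, hx]
  have hj := F.z_jmp hρ hyI'
  have hlt := (F.z_ψP_lt hyI').trans (F.z_ψM_gt hyI')
  have key : ∀ q : ℝ, q / F.d y = q → q = 0 := by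
    intro q hq
    have hd := F.z_d_abs hyII
    have hκ := F.one_lt_κ
    rw [div_eq_iff (F.z_d_ne hyII)] at hq
    have h1 : q * (F.d y - 1) = 0 := by linarith
    rcases mul_eq_zero.1 h1 with h | h
    · exact h
    · have : F.d y = 1 := by linarith
      rw [this, abs_one] at hd
      linarith
  by_cases h1 : F.ψP y = xs
  · have h2 : F.ψM y ≠ xs := fun h => by linarith
    rw [hne _ h2 (hpre _ (F.z_f_ψM hyI)), zero_div, add_zero, h1, ← hyx] at hj
    exact key _ hj.symm
  · rw [hne _ h1 (hpre _ (F.z_f_ψP hyI)), zero_div, zero_add] at hj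
    by_cases h2 : F.ψM y = xs
    · rw [h2, ← hyx] at hj
      exact key _ hj.symm
    · rw [hj, hne _ h2 (hpre _ (F.z_f_ψM hyI)), zero_div]

lemma z_inf_rec (F : PWUnimodal 2) {ρ₀ : ℝ → ℝ} (hρ : F.IsInvDensity ρ₀) (hinf : F.Nf = ⊤)
    (hoff : ∀ y, (∀ n, F.Act n → F.ck n ≠ y) → jmp ρ₀ y = 0) (n : ℕ) :
    jmp ρ₀ (F.ck (n + 1)) = jmp ρ₀ (F.ck 1) / F.dn n (F.ck 1) := by
  induction n with
  | zero => simp [dn]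
  | succ n ih =>
    obtain ⟨x', hx', hne, hfx, hj⟩ := F.z_rec hρ (F.z_ck_mem (n + 1))
      (F.z_inf_ne hinf (by omega : 1 ≤ n + 1))
    have h0 : jmp ρ₀ x' = 0 := by
      refine hoff _ fun m hm hc => hne ?_
      have : F.ck (m + 1) = F.ck (n + 1 + 1) := by
        rw [z_ck_succ, hc, hfx, ← z_ck_succ]
      have := F.z_act_inj (F.z_inf_act hinf (by omega)) (F.z_inf_act hinf (by omega)) this
      have hmn : m = n + 1 := by omega
      rw [← hc, hmn]
    rw [z_ck_succ F (n + 1), hj, h0, ih, z_dn_succ, z_ck_add, zero_div, add_zero, div_div]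

lemma z_geo (F : PWUnimodal 2) {g : ℕ → ℝ} {K : ℝ} {x : ℝ} (hx : x ∈ Icc F.a F.b)
    (hg : ∀ n, |g n| ≤ K) : Summable fun n => g n / F.dn n x := by
  have hκ := F.one_lt_κ
  have hs : Summable fun n : ℕ => K * (F.κ⁻¹) ^ n :=
    (summable_geometric_of_lt_one (by positivity) (inv_lt_one_of_one_lt₀ hκ)).mul_left K
  refine Summable.of_norm_bounded hs fun n => ?_
  rw [Real.norm_eq_abs, abs_div, div_eq_mul_inv, inv_pow]
  have hp : 0 < F.κ ^ n := by positivity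
  exact mul_le_mul (hg n) (inv_anti₀ hp (F.z_dn_abs hx n)) (inv_nonneg.2 (abs_nonneg _))
    ((abs_nonneg _).trans (hg n))

lemma z_Sm_inf (F : PWUnimodal 2) {ρ₀ ρreg : ℝ → ℝ} {s : ℕ → ℝ} (hρ : F.IsInvDensity ρ₀)
    (hdec : F.SaltusDecomp ρ₀ ρreg s) (hinf : F.Nf = ⊤) (x : ℝ) : F.Sm s x := by
  by_contra hx
  have hne : {z | F.Sm s z}.Nonempty := by
    refine ⟨F.b + 1, ?_⟩
    change Summable _
    convert summable_zero using 2 with n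
    have h := (F.z_ck_mem n).2
    have h1 : ¬ F.b + 1 < F.ck n := by linarith
    have h2 : F.b + 1 ≠ F.ck n := by linarith
    simp [Hfun, h1, h2]
  have hbd : BddBelow {z | F.Sm s z} := ⟨x, fun z hz => by
    by_contra hc
    exact hx (F.z_Sm_mono s (not_le.1 hc).le hz)⟩
  set xs := sInf {z | F.Sm s z} with hxs
  have hA : ∀ y, xs < y → ∃ x0 < y, F.Sm s x0 := by
    intro y hy
    obtain ⟨z, hz, hzy⟩ := exists_lt_of_csInf_lt hne hy
    exact ⟨z, hzy, hz⟩
  have hB : ∀ y, y < xs → ∃ x0 > y, ¬ F.Sm s x0 := by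
    intro y hy
    obtain ⟨z, hz1, hz2⟩ := exists_between hy
    exact ⟨z, hz1, fun hz => (notMem_of_lt_csInf hz2 hbd) hz⟩
  have hoff : ∀ y, (∀ n, F.Act n → F.ck n ≠ y) → jmp ρ₀ y = 0 := fun y hy =>
    F.z_inf_off hρ hdec hA hB hy hinf
  have hrec := F.z_inf_rec hρ hinf hoff
  have h1 : jmp ρ₀ (F.ck 1) ≠ 0 := by
    intro h0
    refine F.z_no_jump hρ fun y => ?_
    by_cases hy : ∃ n, F.Act n ∧ F.ck n = y
    · obtain ⟨n, hn, rfl⟩ := hy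
      obtain ⟨k, rfl⟩ : ∃ k, n = k + 1 := ⟨n - 1, by have := hn.1; omega⟩
      rw [hrec, h0, zero_div]
    · push Not at hy
      exact hoff y hy
  have hdn : ∀ n, F.dn n (F.ck 1) ≠ 0 := by
    intro n h0
    have := F.z_dn_abs (F.z_ck_mem 1) n
    rw [h0, abs_zero] at this
    have : 0 < F.κ ^ n := pow_pos (by linarith [F.one_lt_κ]) n
    linarith
  have hge : ∀ n, xs ≤ F.ck (n + 1) := by
    intro n
    by_contra hc
    obtain ⟨x0, hx0, hS⟩ := hB _ (not_le.1 hc)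
    have := F.z_jmp_B hρ hdec hx0 hS
    rw [hrec] at this
    exact (div_ne_zero h1 (hdn n)) this
  have hval : ∀ n, F.ck (n + 1) ≠ xs → F.wt s (n + 1) = jmp ρ₀ (F.ck 1) / F.dn n (F.ck 1) := by
    intro n hn
    obtain ⟨x0, hx0, hS⟩ := hA _ (lt_of_le_of_ne (hge n) hn.symm)
    rw [← hrec, F.z_jmp_A hρ hdec hx0 hS, F.z_tsum_act s (F.z_inf_act hinf (by omega)),
      F.z_wt_of s (F.z_inf_act hinf (by omega))]
  have hsum : Summable (fun n => F.wt s (n + 1)) := by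
    have hg : Summable fun n => jmp ρ₀ (F.ck 1) / F.dn n (F.ck 1) :=
      F.z_geo (F.z_ck_mem 1) (fun _ => le_rfl)
    refine hg.congr_cofinite ?_
    have hfin : {n : ℕ | F.ck (n + 1) = xs}.Finite := by
      refine Set.Subsingleton.finite fun n hn m hm => ?_
      have := F.z_act_inj (F.z_inf_act hinf (by omega : 1 ≤ n + 1))
        (F.z_inf_act hinf (by omega : 1 ≤ m + 1)) (hn.trans hm.symm)
      omega
    filter_upwards [hfin.compl_mem_cofinite] with n hn
    exact (hval n hn).symm
  have hsum' : Summable (F.wt s) := (summable_nat_add_iff 1).1 hsum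
  refine hx (Summable.of_norm_bounded hsum'.abs fun n => ?_)
  rw [Real.norm_eq_abs, abs_mul]
  exact mul_le_of_le_one_right (abs_nonneg _) (z_H_abs_one _ _)

lemma z_Sm_all (F : PWUnimodal 2) {ρ₀ ρreg : ℝ → ℝ} {s : ℕ → ℝ} (hρ : F.IsInvDensity ρ₀)
    (hdec : F.SaltusDecomp ρ₀ ρreg s) (x : ℝ) : F.Sm s x := by
  by_cases h : F.Nf = ⊤
  · exact F.z_Sm_inf hρ hdec h x
  · obtain ⟨N, hN⟩ := ENat.ne_top_iff_exists.1 h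
    exact F.z_Sm_fin s hN.symm x

lemma z_jmp_act (F : PWUnimodal 2) {ρ₀ ρreg : ℝ → ℝ} {s : ℕ → ℝ} (hρ : F.IsInvDensity ρ₀)
    (hdec : F.SaltusDecomp ρ₀ ρreg s) {n : ℕ} (hn : F.Act n) : jmp ρ₀ (F.ck n) = s n := by
  rw [F.z_jmp_A hρ hdec (sub_one_lt _) (F.z_Sm_all hρ hdec _), F.z_tsum_act s hn]

lemma z_jmp_off (F : PWUnimodal 2) {ρ₀ ρreg : ℝ → ℝ} {s : ℕ → ℝ} (hρ : F.IsInvDensity ρ₀)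
    (hdec : F.SaltusDecomp ρ₀ ρreg s) {y : ℝ} (hy : ∀ n, F.Act n → F.ck n ≠ y) :
    jmp ρ₀ y = 0 := by
  rw [F.z_jmp_A hρ hdec (sub_one_lt _) (F.z_Sm_all hρ hdec _), F.z_tsum_off s hy]

end PWUnimodal

namespace PWUnimodal

/-! ### Evaluation of the weighted total jump -/

lemma z_sumTo_fin (N : ℕ) (g : ℕ → ℝ) :
    sumTo (N : ℕ∞) g = ∑ k ∈ Finset.range N, g (k + 1) := by
  unfold sumTo
  rw [tsum_eq_sum (s := Finset.range (N + 1)), Finset.sum_range_succ']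
  · rw [if_neg (by omega : ¬ (1 ≤ 0 ∧ ((0 : ℕ) : ℕ∞) ≤ N)), add_zero]
    refine Finset.sum_congr rfl fun k hk => if_pos ⟨by omega, ?_⟩
    have : k + 1 ≤ N := Finset.mem_range.1 hk
    exact_mod_cast this
  · intro k hk
    refine if_neg ?_
    rintro ⟨-, h⟩
    have : k ≤ N := by exact_mod_cast h
    exact hk (Finset.mem_range.2 (by omega))

lemma z_sumTo_top (g : ℕ → ℝ) : sumTo ⊤ g = ∑' k, g (k + 1) := by
  unfold sumTo
  rw [← (Nat.succ_injective).tsum_eq]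
  · exact tsum_congr fun k => if_pos ⟨by simp, le_top⟩
  · intro n hn
    rcases n with _ | n
    · simp at hn
    · exact ⟨n, rfl⟩

lemma z_step (F : PWUnimodal 2) {ρ₀ ρreg : ℝ → ℝ} {s : ℕ → ℝ} (hρ : F.IsInvDensity ρ₀)
    (hdec : F.SaltusDecomp ρ₀ ρreg s) {n : ℕ} (h0 : F.Act n) (h1 : F.Act (n + 1))
    (hc : F.ck n ≠ F.c) (h : ∀ m, F.Act m → F.ck (m + 1) = F.ck (n + 1) → m = n) :
    s (n + 1) = s n / F.d (F.ck n) := by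
  obtain ⟨x', hx', hne, hfx, hj⟩ := F.z_rec hρ (F.z_ck_mem n) hc
  have hz : jmp ρ₀ x' = 0 := by
    refine F.z_jmp_off hρ hdec fun m hm hcm => hne ?_
    rw [← hcm, h m hm]
    rw [z_ck_succ, hcm, hfx, ← z_ck_succ]
  rw [hz, zero_div, add_zero, ← z_ck_succ, F.z_jmp_act hρ hdec h0, F.z_jmp_act hρ hdec h1] at hj
  exact hj

lemma z_step_prod (F : PWUnimodal 2) {s : ℕ → ℝ} (k : ℕ)
    (h : ∀ n, 1 ≤ n → n ≤ k → s (n + 1) = s n / F.d (F.ck n)) :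
    s (k + 1) = s 1 / F.dn k (F.ck 1) := by
  induction k with
  | zero => simp [dn]
  | succ k ih =>
    rw [h (k + 1) (by omega) le_rfl, ih fun n h1 h2 => h n h1 (by omega), z_dn_succ, z_ck_add,
      div_div]

lemma z_two (F : PWUnimodal 2) {x y z : ℝ} (hx : x ∈ Icc F.a F.b) (hy : y ∈ Icc F.a F.b)
    (hz : z ∈ Icc F.a F.b) (h1 : F.f y = F.f x) (h2 : F.f z = F.f x) (hyx : y ≠ x)
    (hzx : z ≠ x) : y = z := by
  have hp : ∀ u v, u ∈ Icc F.a F.b → v ∈ Icc F.a F.b → u ≤ F.c → v ≤ F.c → F.f u = F.f v →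
      u = v := fun u v hu hv h h' he => F.mono.injOn ⟨hu.1, h⟩ ⟨hv.1, h'⟩ he
  have hm : ∀ u v, u ∈ Icc F.a F.b → v ∈ Icc F.a F.b → F.c ≤ u → F.c ≤ v → F.f u = F.f v →
      u = v := fun u v hu hv h h' he => F.anti.injOn ⟨h, hu.2⟩ ⟨h', hv.2⟩ he
  rcases le_total x F.c with a | a <;> rcases le_total y F.c with b | b
  · exact (hyx (hp _ _ hy hx b a h1)).elim
  · rcases le_total z F.c with c | c
    · exact (hzx (hp _ _ hz hx c a h2)).elim
    · exact hm _ _ hy hz b c (h1.trans h2.symm)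
  · rcases le_total z F.c with c | c
    · exact hp _ _ hy hz b c (h1.trans h2.symm)
    · exact (hzx (hm _ _ hz hx c a h2)).elim
  · exact (hyx (hm _ _ hy hx b a h1)).elim

/-- The series of values of `X` along the orbit, weighted by inverse derivatives. -/
def sig (F : PWUnimodal 2) (X : ℝ → ℝ) (x : ℝ) : ℝ := ∑' k, X (F.f^[k] x) / F.dn k x

lemma z_sig_summable (F : PWUnimodal 2) {X : ℝ → ℝ} (hX : ∃ M, ∀ x ∈ Icc F.a F.b, |X x| ≤ M)
    {x : ℝ} (hx : x ∈ Icc F.a F.b) : Summable fun k => X (F.f^[k] x) / F.dn k x := by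
  obtain ⟨M, hM⟩ := hX
  exact F.z_geo hx (g := fun k => X (F.f^[k] x)) fun n => hM _ (F.mapsI.iterate n hx)

lemma z_sig_shift (F : PWUnimodal 2) {X : ℝ → ℝ} (hX : ∃ M, ∀ x ∈ Icc F.a F.b, |X x| ≤ M)
    {x : ℝ} (hx : x ∈ Icc F.a F.b) :
    F.sig X x = X x + ∑' j, X (F.f^[j + 1] x) / F.dn (j + 1) x := by
  unfold sig
  rw [(F.z_sig_summable hX hx).tsum_eq_zero_add]
  simp [dn]

lemma z_sig_rec (F : PWUnimodal 2) {X : ℝ → ℝ} (hX : ∃ M, ∀ x ∈ Icc F.a F.b, |X x| ≤ M)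
    {x : ℝ} (hx : x ∈ Icc F.a F.b) :
    F.sig X x = X x + F.sig X (F.f x) / F.d x := by
  rw [F.z_sig_shift hX hx, sig, ← tsum_div_const]
  congr 1
  refine tsum_congr fun j => ?_
  rw [Function.iterate_succ_apply, div_div]
  congr 1
  simp only [dn, Finset.prod_range_succ', Function.iterate_succ_apply, Function.iterate_zero,
    id_eq]

lemma z_cp_iff (F : PWUnimodal 2) : F.CritPeriodic ↔ F.c ∈ Function.periodicPts F.f := Iff.rfl

lemma z_ne_c (F : PWUnimodal 2) (h : ¬ F.CritPeriodic) {n : ℕ} (hn : 1 ≤ n) : F.ck n ≠ F.c :=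
  fun hc => h ⟨n, hn, hc⟩

lemma z_J_per (F : PWUnimodal 2) {ρ₀ ρreg : ℝ → ℝ} {s : ℕ → ℝ} (hρ : F.IsInvDensity ρ₀)
    (hdec : F.SaltusDecomp ρ₀ ρreg s) (h : F.CritPeriodic) (X : ℝ → ℝ) :
    F.Jfun s X = s 1 * ∑ k ∈ Finset.range (Function.minimalPeriod F.f F.c),
      X (F.ck (k + 1)) / F.dn k (F.ck 1) := by
  have hN : F.Nf = (Function.minimalPeriod F.f F.c : ℕ∞) := if_pos h
  set p := Function.minimalPeriod F.f F.c with hp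
  have hact : ∀ n, 1 ≤ n → n ≤ p → F.Act n := fun n h1 h2 => ⟨h1, by rw [hN]; exact_mod_cast h2⟩
  have hactle : ∀ n, F.Act n → n ≤ p := fun n hn => by
    have := hn.2
    rw [hN] at this
    exact_mod_cast this
  have hcp : F.ck p = F.c := Function.iterate_minimalPeriod
  rw [Jfun, hN, z_sumTo_fin, Finset.mul_sum]
  refine Finset.sum_congr rfl fun k hk => ?_
  have hk' : k < p := Finset.mem_range.1 hk
  rw [F.z_step_prod (s := s) k]
  · ring
  intro n h1 h2
  refine F.z_step hρ hdec (hact n h1 (by omega)) (hact _ (by omega) (by omega)) ?_ ?_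
  · intro hc
    have := F.z_act_inj (hact n h1 (by omega)) (hact p (by omega) le_rfl) (hc.trans hcp.symm)
    omega
  · intro m hm he
    have hmp := hactle m hm
    rcases hmp.eq_or_lt with h3 | h3
    · rw [z_ck_succ F m, h3, hcp] at he
      have := F.z_act_inj (hact 1 le_rfl (by omega)) (hact (n + 1) (by omega) (by omega)) he
      omega
    · have := F.z_act_inj (hact (m + 1) (by omega) (by omega)) (hact (n + 1) (by omega) (by omega))
        he
      omega

lemma z_J_inf (F : PWUnimodal 2) {ρ₀ ρreg : ℝ → ℝ} {s : ℕ → ℝ} (hρ : F.IsInvDensity ρ₀)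
    (hdec : F.SaltusDecomp ρ₀ ρreg s) (hinf : F.Nf = ⊤) (X : ℝ → ℝ) :
    F.Jfun s X = s 1 * F.sig X (F.ck 1) := by
  rw [Jfun, hinf, z_sumTo_top, sig, ← tsum_mul_left]
  refine tsum_congr fun k => ?_
  rw [F.z_step_prod (s := s) k, z_ck_add]
  · ring
  intro n h1 h2
  refine F.z_step hρ hdec (F.z_inf_act hinf h1) (F.z_inf_act hinf (by omega))
    (F.z_inf_ne hinf h1) fun m hm he => ?_
  have := F.z_act_inj (F.z_inf_act hinf (by omega)) (F.z_inf_act hinf (by omega)) he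
  omega

/-- Description of the strictly preperiodic case. -/
lemma z_pre (F : PWUnimodal 2) (h : ¬ F.CritPeriodic) (hinf : F.Nf ≠ ⊤) :
    ∃ n0 N : ℕ, 2 ≤ n0 ∧ n0 ≤ N ∧ F.Nf = N ∧ F.ck (N + 1) = F.ck n0 := by
  classical
  unfold Nf at *
  have h' : F.c ∉ Function.periodicPts F.f := h
  simp only [if_neg h'] at *
  split_ifs at * with h2
  · obtain ⟨h3, h4⟩ := Nat.find_spec h2
    have hq := Function.minimalPeriod_pos_of_mem_periodicPts h4
    have hq' := Function.iterate_minimalPeriod (f := F.f) (x := F.f^[Nat.find h2] F.c)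
    generalize Nat.find h2 = n0 at *
    generalize Function.minimalPeriod F.f (F.f^[n0] F.c) = q at *
    have hq2 : F.ck (q + n0) = F.ck n0 := by
      rw [← z_ck_add]; exact hq'
    refine ⟨n0, n0 + q - 1, ?_, by omega, rfl, ?_⟩
    · by_contra hlt
      have : n0 = 1 := by omega
      subst this
      rw [z_ck_succ] at hq2
      have hlt := F.z_lt_c1 (F.z_ck_mem q) (F.z_ne_c h hq)
      rw [hq2] at hlt
      exact lt_irrefl _ hlt
    · rw [← hq2]
      congr 1
      omega
  · exact (hinf rfl).elim

lemma z_J_pre (F : PWUnimodal 2) {ρ₀ ρreg : ℝ → ℝ} {s : ℕ → ℝ} (hρ : F.IsInvDensity ρ₀)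
    (hdec : F.SaltusDecomp ρ₀ ρreg s) (h : ¬ F.CritPeriodic) (hinf : F.Nf ≠ ⊤) {X : ℝ → ℝ}
    (hX : ∃ M, ∀ x ∈ Icc F.a F.b, |X x| ≤ M) :
    F.Jfun s X = s 1 * F.sig X (F.ck 1) := by
  obtain ⟨n0, N, h2, hn0, hN, hper⟩ := F.z_pre h hinf
  have hact : ∀ n, 1 ≤ n → n ≤ N → F.Act n := fun n h1 h2 => ⟨h1, by rw [hN]; exact_mod_cast h2⟩
  have hactle : ∀ n, F.Act n → n ≤ N := fun n hn => by
    have := hn.2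
    rw [hN] at this
    exact_mod_cast this
  have hstep : ∀ n, 1 ≤ n → n < N → n + 1 ≠ n0 → s (n + 1) = s n / F.d (F.ck n) := by
    intro n h1 h3 h4
    refine F.z_step hρ hdec (hact n h1 (by omega)) (hact _ (by omega) (by omega))
      (F.z_ne_c h h1) fun m hm he => ?_
    rcases (hactle m hm).eq_or_lt with h5 | h5
    · rw [h5, hper] at he
      have := F.z_act_inj (hact n0 (by omega) hn0) (hact (n + 1) (by omega) (by omega)) he
      omega
    · have := F.z_act_inj (hact (m + 1) (by omega) (by omega)) (hact (n + 1) (by omega) (by omega))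
        he
      omega
  have hstep0 : ∀ n, 1 ≤ n → n + 1 = n0 →
      s (n + 1) = s n / F.d (F.ck n) + s N / F.d (F.ck N) := by
    intro n h1 h3
    obtain ⟨x', hx', hne, hfx, hj⟩ := F.z_rec hρ (F.z_ck_mem n) (F.z_ne_c h h1)
    have hx : x' = F.ck N := by
      refine F.z_two (F.z_ck_mem n) hx' (F.z_ck_mem N) hfx ?_ hne ?_
      · rw [← z_ck_succ, ← z_ck_succ, hper, h3]
      · intro he
        have := F.z_act_inj (hact N (by omega) le_rfl) (hact n h1 (by omega)) he
        omega
    rw [hx, ← z_ck_succ, F.z_jmp_act hρ hdec (hact n h1 (by omega)),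
      F.z_jmp_act hρ hdec (hact N (by omega) le_rfl),
      F.z_jmp_act hρ hdec (hact (n + 1) (by omega) (by omega))] at hj
    exact hj
  have hσ : ∀ n, F.sig X (F.ck n) = X (F.ck n) + F.sig X (F.ck (n + 1)) / F.d (F.ck n) :=
    fun n => by rw [F.z_sig_rec hX (F.z_ck_mem n), ← z_ck_succ]
  have key : ∀ k, 1 ≤ k → k ≤ N → ∑ j ∈ Finset.range k, s (j + 1) * X (F.ck (j + 1)) =
      s 1 * F.sig X (F.ck 1) + (if n0 ≤ k then s N / F.d (F.ck N) * F.sig X (F.ck n0) else 0)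
        - s k / F.d (F.ck k) * F.sig X (F.ck (k + 1)) := by
    intro k hk
    induction k, hk using Nat.le_induction with
    | base =>
      intro _
      rw [if_neg (by omega), hσ 1]
      simp only [Finset.range_one, Finset.sum_singleton, zero_add]
      ring
    | succ k hk ih =>
      intro hkN
      rw [Finset.sum_range_succ, ih (by omega)]
      have hX1 : X (F.ck (k + 1)) =
          F.sig X (F.ck (k + 1)) - F.sig X (F.ck (k + 1 + 1)) / F.d (F.ck (k + 1)) := by
        rw [hσ (k + 1)]; ring
      rw [hX1, mul_sub]
      by_cases hc : k + 1 = n0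
      · rw [if_neg (by omega), if_pos (by omega), ← hc]
        have e := congrArg (· * F.sig X (F.ck (k + 1))) (hstep0 k hk hc)
        simp only [add_mul] at e
        rw [e]
        ring
      · have e := congrArg (· * F.sig X (F.ck (k + 1))) (hstep k hk (by omega) hc)
        beta_reduce at e
        rw [e]
        have hi : (n0 ≤ k + 1) ↔ n0 ≤ k := by omega
        simp only [hi]
        ring
  rw [Jfun, hN, z_sumTo_fin, key N (by omega) le_rfl, if_pos hn0, hper]
  ring

open scoped Classical in
/-- The common value of the horizontality sum. -/
def Sig (F : PWUnimodal 2) (X : ℝ → ℝ) : ℝ :=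
  if F.CritPeriodic then
    ∑ k ∈ Finset.range (Function.minimalPeriod F.f F.c), X (F.ck (k + 1)) / F.dn k (F.ck 1)
  else F.sig X (F.ck 1)

lemma z_J (F : PWUnimodal 2) {ρ₀ ρreg : ℝ → ℝ} {s : ℕ → ℝ} (hρ : F.IsInvDensity ρ₀)
    (hdec : F.SaltusDecomp ρ₀ ρreg s) {X : ℝ → ℝ}
    (hX : ∃ M, ∀ x ∈ Icc F.a F.b, |X x| ≤ M) :
    F.Jfun s X = s 1 * F.Sig X := by
  unfold Sig
  split_ifs with h
  · exact F.z_J_per hρ hdec h X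
  · by_cases hinf : F.Nf = ⊤
    · exact F.z_J_inf hρ hdec hinf X
    · exact F.z_J_pre hρ hdec h hinf hX

lemma z_Sig_hor (F : PWUnimodal 2) (X : ℝ → ℝ) :
    F.Horizontal (fun x => X (F.f x)) ↔ F.Sig X = 0 := by
  unfold Horizontal Sig
  split_ifs with h
  · simp only [h, forall_true_left, not_true, false_imp_iff, and_true, z_ck_succ]
  · simp only [h, false_imp_iff, not_false_eq_true, forall_true_left, true_and, sig, z_ck_add,
      ← z_ck_succ]

lemma z_Sig_alpha (F : PWUnimodal 2) {X : ℝ → ℝ}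
    (hX : ∃ M, ∀ x ∈ Icc F.a F.b, |X x| ≤ M) :
    X (F.ck 1) - F.alpha0 (fun x => X (F.f x)) (F.ck 1) = F.Sig X := by
  classical
  by_cases h : F.CritPeriodic
  · have hpos := Function.minimalPeriod_pos_of_mem_periodicPts (F.z_cp_iff.1 h)
    have hcp : F.ck (Function.minimalPeriod F.f F.c) = F.c := Function.iterate_minimalPeriod
    have hmin : ∀ n, 0 < n → F.ck n = F.c → Function.minimalPeriod F.f F.c ≤ n := fun n hn hc =>
      Function.IsPeriodicPt.minimalPeriod_le hn hc
    rw [Sig, if_pos h]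
    generalize Function.minimalPeriod F.f F.c = p at *
    have hp1 : p ≠ 1 := by
      rintro rfl
      have := F.z_c_lt
      change F.f F.c = F.c at hcp
      linarith
    have hex : ∃ ℓ, 1 ≤ ℓ ∧ F.f^[ℓ] (F.ck 1) = F.c :=
      ⟨p - 1, by omega, by rw [z_ck_add, Nat.sub_add_cancel (by omega), hcp]⟩
    have hfind : Nat.find hex = p - 1 := by
      rw [Nat.find_eq_iff]
      refine ⟨⟨by omega, by rw [z_ck_add, Nat.sub_add_cancel (by omega), hcp]⟩, ?_⟩
      rintro n hn ⟨h1, h2⟩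
      rw [z_ck_add] at h2
      have := hmin _ (by omega) h2
      omega
    obtain ⟨q, rfl⟩ : ∃ q, p = q + 1 := ⟨p - 1, by omega⟩
    unfold alpha0
    rw [dif_pos hex]
    have hfind' : Nat.find hex = q := by rw [hfind]; rfl
    rw [Finset.sum_range_succ', hfind']
    simp only [z_ck_add, ← z_ck_succ]
    have hd0 : F.dn 0 (F.ck 1) = 1 := by simp [dn]
    rw [hd0, div_one, sub_neg_eq_add, add_comm]
  · rw [Sig, if_neg h, F.z_sig_shift hX (F.z_ck_mem 1)]
    unfold alpha0
    rw [dif_neg, sub_neg_eq_add]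
    · simp only [Function.iterate_succ_apply']
    · rintro ⟨n, hn, hc⟩
      rw [z_ck_add] at hc
      exact F.z_ne_c h (by omega) hc

lemma z_s1 (F : PWUnimodal 2) {ρ₀ ρreg : ℝ → ℝ} {s : ℕ → ℝ} (hρ : F.IsInvDensity ρ₀)
    (hdec : F.SaltusDecomp ρ₀ ρreg s) : s 1 ≠ 0 := by
  classical
  intro h0
  refine F.z_no_jump hρ fun y => ?_
  by_cases hy : ∃ n, F.Act n ∧ F.ck n = y
  · obtain ⟨n, hn, rfl⟩ := hy
    rw [F.z_jmp_act hρ hdec hn]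
    have hJ := F.z_J hρ hdec (X := fun x => if x = F.ck n then 1 else 0)
      ⟨1, fun x _ => by split_ifs <;> simp⟩
    rw [h0, zero_mul, Jfun, sumTo, tsum_eq_single n] at hJ
    · have hn' : 1 ≤ n ∧ (n : ℕ∞) ≤ F.Nf := hn
      simpa [hn'] using hJ
    · intro m hm
      split_ifs with h1 h2
      · exact (hm (F.z_act_inj h1 hn h2)).elim
      · simp
      · rfl
  · push Not at hy
    exact F.z_jmp_off hρ hdec hy

end PWUnimodal

/-- Lemma 4.2. For a piecewise expanding `C²` unimodal map and bounded `X`,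
`J(f,X) = s₁ (X(c₁) - α_{(0)}(c₁))`; in particular `J(f,X) = 0` iff `X ∘ f` is horizontal. -/
theorem stmt_7 (F : PWUnimodal 2) (X : ℝ → ℝ)
    (hX : ∃ M, ∀ x ∈ Set.Icc F.a F.b, |X x| ≤ M)
    (ρ₀ ρreg : ℝ → ℝ) (s : ℕ → ℝ)
    (hρ₀ : F.IsInvDensity ρ₀) (hdec : F.SaltusDecomp ρ₀ ρreg s) :
    F.Jfun s X = s 1 * (X (F.ck 1) - F.alpha0 (fun x => X (F.f x)) (F.ck 1)) ∧
    (F.Jfun s X = 0 ↔ F.Horizontal (fun x => X (F.f x))) := by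
  have hJ := F.z_J hρ₀ hdec hX
  refine ⟨by rw [hJ, F.z_Sig_alpha hX], ?_⟩
  rw [hJ, F.z_Sig_hor, mul_eq_zero]
  exact ⟨fun h => h.resolve_left (F.z_s1 hρ₀ hdec), Or.inr⟩

end
end

section
/- Let f_t be a C^{2,2} perturbation of a mixing piecewise expanding C^2 unimodal map f with infinitesimal deformation v = ∂_t f_t|_{t=0}. If v is not horizontal for f, then there is a sequence t_n → 0 such that the critical point c has an infinite forward orbit under each f_{t_n}. -/
open Set MeasureTheory Filter Topology

noncomputable section

theorem aux_tube (G : ℝ × ℝ → ℝ) (W : Set (ℝ × ℝ)) (u w : ℝ) (hW : IsOpen W)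
    (hsub : (Icc u w) ×ˢ ({0} : Set ℝ) ⊆ W) (hG : ContDiffOn ℝ 2 G W) :
    ∃ δ > 0, ∃ C ≥ 0, ∀ x ∈ Icc u w, ∀ t s : ℝ, |t| < δ → |s| < δ →
      (x, t) ∈ W ∧ |G (x, t) - G (x, s)| ≤ C * |t - s| := by
  obtain ⟨U, V, hU, hV, hsU, hV0, hUV⟩ := generalized_tube_lemma isCompact_Icc isCompact_singleton hW hsub
  obtain ⟨δ, hδ, hδV⟩ := Metric.isOpen_iff.1 hV 0 (hV0 rfl)
  have hin : ∀ x ∈ Icc u w, ∀ t : ℝ, |t| < δ → (x, t) ∈ W := by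
    intro x hx t ht
    exact hUV ⟨hsU hx, hδV (by simpa [Metric.mem_ball, dist_eq_norm] using ht)⟩
  set S : Set (ℝ × ℝ) := Icc u w ×ˢ Icc (-(δ/2)) (δ/2) with hS
  have hSW : S ⊆ W := by
    rintro ⟨x, t⟩ ⟨hx, ht⟩
    apply hin x hx
    have := abs_le.2 ht
    simp at this; linarith
  have hSc : IsCompact S := isCompact_Icc.prod isCompact_Icc
  have hcont : ContinuousOn (fun z => fderiv ℝ G z) S :=
    (hG.continuousOn_fderiv_of_isOpen hW (by norm_num)).mono hSW
  obtain ⟨C, hC⟩ := hSc.exists_bound_of_continuousOn hcont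
  refine ⟨δ/2, by positivity, |C|, abs_nonneg _, ?_⟩
  intro x hx t s ht hs
  refine ⟨hin x hx t (by linarith), ?_⟩
  have hconv : Convex ℝ S := (convex_Icc _ _).prod (convex_Icc _ _)
  have := hconv.norm_image_sub_le_of_norm_fderiv_le (f := G) (C := |C|) (x := (x, s)) (y := (x, t))
    (fun z hz => ((hG z (hSW hz)).contDiffAt (hW.mem_nhds (hSW hz))).differentiableAt (by norm_num))
    (fun z hz => (hC z hz).trans (le_abs_self _)) ⟨hx, abs_le.1 hs.le⟩ ⟨hx, abs_le.1 ht.le⟩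
  simpa [Prod.norm_def] using this

theorem aux_cont (g : ℝ → ℝ → ℝ) (a b c C x y : ℝ)
    (hc : c ∈ Icc a b)
    (hmaps : ∀ t ∈ Ioo x y, MapsTo (g t) (Icc a b) (Icc a b))
    (hcont : ∀ t ∈ Ioo x y, ContinuousOn (g t) (Icc a b))
    (hlip : ∀ t ∈ Ioo x y, ∀ s ∈ Ioo x y, ∀ z ∈ Icc a b, |g t z - g s z| ≤ C * |t - s|) (k : ℕ) :
    (∀ t ∈ Ioo x y, (g t)^[k] c ∈ Icc a b) ∧ ContinuousOn (fun t => (g t)^[k] c) (Ioo x y) := by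
  induction k with
  | zero => exact ⟨fun t _ => hc, continuousOn_const⟩
  | succ k ih =>
    obtain ⟨ih1, ih2⟩ := ih
    constructor
    · intro t ht
      rw [Function.iterate_succ_apply']
      exact hmaps t ht (ih1 t ht)
    · intro t ht
      simp only [Function.iterate_succ_apply']
      have h1 : Tendsto (fun s => g t ((g s)^[k] c)) (𝓝[Ioo x y] t) (𝓝 (g t ((g t)^[k] c))) := by
        have := (hcont t ht).comp ih2 (fun s hs => ih1 s hs)
        exact this t ht
      have h2 : Tendsto (fun s => g s ((g s)^[k] c) - g t ((g s)^[k] c)) (𝓝[Ioo x y] t) (𝓝 0) := by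
        have h3 : Tendsto (fun s => C * |s - t|) (𝓝[Ioo x y] t) (𝓝 0) := by
          have : Continuous (fun s : ℝ => C * |s - t|) := by fun_prop
          have := (this.tendsto t).mono_left (nhdsWithin_le_nhds (s := Ioo x y))
          simpa using this
        apply squeeze_zero_norm' _ h3
        filter_upwards [self_mem_nhdsWithin] with s hs
        exact hlip s hs t ht _ (ih1 s hs)
      have := h2.add h1
      simpa [ContinuousWithinAt] using this

theorem aux_main (g : ℝ → ℝ → ℝ) (a b c κ C x y : ℝ) (K : ℕ) (hxy : x < y)
    (hc : c ∈ Icc a b) (hκ : 1 < κ) (hC : 0 ≤ C)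
    (hmaps : ∀ t ∈ Ioo x y, MapsTo (g t) (Icc a b) (Icc a b))
    (hcont : ∀ t ∈ Ioo x y, ContinuousOn (g t) (Icc a b))
    (hlip : ∀ t ∈ Ioo x y, ∀ s ∈ Ioo x y, ∀ z ∈ Icc a b, |g t z - g s z| ≤ C * |t - s|)
    (hexp1 : ∀ t ∈ Ioo x y, ∀ z ∈ Icc a c, ∀ w ∈ Icc a c, κ * |z - w| ≤ |g t z - g t w|)
    (hexp2 : ∀ t ∈ Ioo x y, ∀ z ∈ Icc c b, ∀ w ∈ Icc c b, κ * |z - w| ≤ |g t z - g t w|)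
    (hK : ∀ t ∈ Ioo x y, ∀ s ∈ Ioo x y,
      (C / (κ - 1) + 1) * |t - s| ≤ |(g t)^[K] c - (g s)^[K] c|) :
    ∃ t ∈ Ioo x y, Function.Injective fun k : ℕ => (g t)^[k] c := by
  have hO := aux_cont g a b c C x y hc hmaps hcont hlip
  -- growth
  have grow : ∀ x' y', Ioo x' y' ⊆ Ioo x y → ∀ i : ℕ,
      (∀ j, K ≤ j → j < K + i → ∀ t ∈ Ioo x' y', (g t)^[j] c ≠ c) →
      ∀ t ∈ Ioo x' y', ∀ s ∈ Ioo x' y',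
        (C / (κ - 1) + κ ^ i) * |t - s| ≤ |(g t)^[K + i] c - (g s)^[K + i] c| := by
    intro x' y' hsub i
    induction i with
    | zero => intro _ t ht s hs; simpa using hK t (hsub ht) s (hsub hs)
    | succ i ih =>
      intro hne t ht s hs
      have ih' := ih (fun j h1 h2 => hne j h1 (by omega)) t ht s hs
      have hne' := hne (K + i) (by omega) (by omega)
      have hct := (hO (K + i)).2.mono hsub
      have mt := (hO (K + i)).1 t (hsub ht)
      have ms := (hO (K + i)).1 s (hsub hs)
      have hside : ((g t)^[K+i] c ∈ Icc a c ∧ (g s)^[K+i] c ∈ Icc a c) ∨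
          ((g t)^[K+i] c ∈ Icc c b ∧ (g s)^[K+i] c ∈ Icc c b) := by
        rcases le_total ((g t)^[K+i] c) c with h1 | h1 <;>
        rcases le_total ((g s)^[K+i] c) c with h2 | h2
        · exact Or.inl ⟨⟨mt.1, h1⟩, ⟨ms.1, h2⟩⟩
        · exfalso
          obtain ⟨r, hr, hr'⟩ := isPreconnected_Ioo.intermediate_value ht hs hct ⟨h1, h2⟩
          exact hne' r hr hr'
        · exfalso
          obtain ⟨r, hr, hr'⟩ := isPreconnected_Ioo.intermediate_value hs ht hct ⟨h2, h1⟩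
          exact hne' r hr hr'
        · exact Or.inr ⟨⟨h1, mt.2⟩, ⟨h2, ms.2⟩⟩
      have hE : κ * |(g t)^[K+i] c - (g s)^[K+i] c| ≤
          |g t ((g t)^[K+i] c) - g t ((g s)^[K+i] c)| := by
        rcases hside with h | h
        · exact hexp1 t (hsub ht) _ h.1 _ h.2
        · exact hexp2 t (hsub ht) _ h.1 _ h.2
      have hL := hlip s (hsub hs) t (hsub ht) _ ms
      rw [abs_sub_comm s t] at hL
      rw [← Nat.add_assoc, Function.iterate_succ_apply', Function.iterate_succ_apply']
      have htri : |g t ((g t)^[K+i] c) - g t ((g s)^[K+i] c)| ≤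
          |g t ((g t)^[K+i] c) - g s ((g s)^[K+i] c)| +
          |g s ((g s)^[K+i] c) - g t ((g s)^[K+i] c)| := abs_sub_le _ _ _
      have h5 : κ * ((C / (κ - 1) + κ ^ i) * |t - s|) ≤ κ * |(g t)^[K + i] c - (g s)^[K + i] c| :=
        mul_le_mul_of_nonneg_left ih' (by linarith)
      have h6 : κ * ((C / (κ - 1) + κ ^ i) * |t - s|) - C * |t - s|
          = (C / (κ - 1) + κ ^ (i+1)) * |t - s| := by
        have : κ - 1 ≠ 0 := by linarith
        field_simp
        ring
      linarith
  -- avoidance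
  have avoid : ∀ x' y', x' < y' → Ioo x' y' ⊆ Ioo x y → ∀ i : ℕ,
      ∃ x'' y'', x'' < y'' ∧ Ioo x'' y'' ⊆ Ioo x' y' ∧
      (∀ j, K ≤ j → j < K + i → ∀ t ∈ Ioo x'' y'', (g t)^[j] c ≠ c) := by
    intro x' y' hxy' hsub i
    induction i with
    | zero => exact ⟨x', y', hxy', subset_rfl, fun j h1 h2 => by omega⟩
    | succ i ih =>
      obtain ⟨p, q, hpq, hsub', hne⟩ := ih
      have hgr := grow p q (hsub'.trans hsub) i hne
      have hex : ∃ t ∈ Ioo p q, (g t)^[K + i] c ≠ c := by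
        by_contra! hcon
        have m1 : (2 * p + q) / 3 ∈ Ioo p q := ⟨by linarith, by linarith⟩
        have m2 : (p + 2 * q) / 3 ∈ Ioo p q := ⟨by linarith, by linarith⟩
        have := hgr _ m1 _ m2
        rw [hcon _ m1, hcon _ m2] at this
        have hp : 0 < |(2 * p + q) / 3 - (p + 2 * q) / 3| := abs_pos.2 (by intro h; linarith)
        have hq : 0 < C / (κ - 1) + κ ^ i := by
          have : 0 ≤ C / (κ - 1) := div_nonneg hC (by linarith)
          have : 0 < κ ^ i := by positivity
          linarith
        have := mul_pos hq hp
        simp at *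
        linarith
      obtain ⟨t, ht, hne_t⟩ := hex
      have hct : ContinuousAt (fun t => (g t)^[K + i] c) t :=
        (hO (K + i)).2.continuousAt (isOpen_Ioo.mem_nhds (hsub (hsub' ht)))
      have hev : ∀ᶠ s in 𝓝 t, (g s)^[K + i] c ≠ c ∧ s ∈ Ioo p q :=
        (hct.eventually_ne hne_t).and (isOpen_Ioo.mem_nhds ht)
      obtain ⟨l, u, htlu, hlu⟩ := mem_nhds_iff_exists_Ioo_subset.1 hev
      refine ⟨l, u, htlu.1.trans htlu.2, fun s hs => hsub' (hlu hs).2, ?_⟩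
      intro j h1 h2 s hs
      rcases Nat.lt_or_ge j (K + i) with h | h
      · exact hne j h1 h s (hlu hs).2
      · have : j = K + i := by omega
        subst this
        exact (hlu hs).1
  -- Baire
  by_contra! hcon
  have hB : BaireSpace (Ioo x y) := isOpen_Ioo.baireSpace
  have hN : Nonempty (Ioo x y) := ⟨⟨(x + y) / 2, by linarith, by linarith⟩⟩
  let Z : ℕ × ℕ → Set (Ioo x y) := fun p =>
    {t | p.1 < p.2 ∧ (g t.1)^[p.1] c = (g t.1)^[p.2] c}
  have hZc : ∀ p, IsClosed (Z p) := by
    intro p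
    have h1 : Continuous (fun t : Ioo x y => (g t.1)^[p.1] c) :=
      continuousOn_iff_continuous_domRestrict.1 (hO p.1).2
    have h2 : Continuous (fun t : Ioo x y => (g t.1)^[p.2] c) :=
      continuousOn_iff_continuous_domRestrict.1 (hO p.2).2
    exact isClosed_const.and (isClosed_eq h1 h2)
  have hZu : ⋃ p, Z p = univ := by
    rw [eq_univ_iff_forall]
    intro t
    have := hcon t.1 t.2
    rw [Function.Injective] at this
    push Not at this
    obtain ⟨m, n, hmn, hne⟩ := this
    rw [mem_iUnion]
    rcases lt_or_gt_of_ne hne with h | h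
    · exact ⟨(m, n), h, hmn⟩
    · exact ⟨(n, m), h, hmn.symm⟩
  obtain ⟨⟨m, n⟩, ⟨t0, ht0⟩⟩ := nonempty_interior_of_iUnion_of_closed hZc hZu
  have hop : IsOpen (Subtype.val '' interior (Z (m, n))) :=
    isOpen_Ioo.isOpenMap_subtype_val _ isOpen_interior
  obtain ⟨p, q, hpq, hpqs⟩ := mem_nhds_iff_exists_Ioo_subset.1 (hop.mem_nhds ⟨t0, ht0, rfl⟩)
  have hlt : p < q := hpq.1.trans hpq.2
  have hmn : m < n := (interior_subset ht0).1
  have hsub : Ioo p q ⊆ Ioo x y := by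
    intro s hs
    obtain ⟨r, -, rfl⟩ := hpqs hs
    exact r.2
  have heq : ∀ s ∈ Ioo p q, (g s)^[m] c = (g s)^[n] c := by
    intro s hs
    obtain ⟨r, hr, rfl⟩ := hpqs hs
    exact (interior_subset hr).2
  obtain ⟨p', q', hlt', hsub', hne⟩ := avoid p q hlt hsub n
  have hne_all : ∀ j, K ≤ j → ∀ s ∈ Ioo p' q', (g s)^[j] c ≠ c := by
    intro j
    induction j using Nat.strong_induction_on with
    | _ j ih =>
      intro hj s hs
      rcases Nat.lt_or_ge j (K + n) with h | h
      · exact hne j hj h s hs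
      · have e1 : (g s)^[j] c = (g s)^[j - n + m] c := by
          have : j = (j - n) + n := by omega
          conv_lhs => rw [this]
          rw [Function.iterate_add_apply, Function.iterate_add_apply, heq s (hsub' hs)]
        rw [e1]
        exact ih _ (by omega) (by omega) s hs
  have hgr := fun i => grow p' q' (hsub'.trans hsub) i (fun j h1 _ => hne_all j h1)
  have m1 : (2 * p' + q') / 3 ∈ Ioo p' q' := ⟨by linarith, by linarith⟩
  have m2 : (p' + 2 * q') / 3 ∈ Ioo p' q' := ⟨by linarith, by linarith⟩
  set τ := |(2 * p' + q') / 3 - (p' + 2 * q') / 3| with hτ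
  have hp : 0 < τ := abs_pos.2 (by intro h; linarith)
  obtain ⟨i, hi⟩ := pow_unbounded_of_one_lt ((b - a) / τ) hκ
  have h1 := hgr i _ m1 _ m2
  have h2 := (hO (K + i)).1 _ (hsub (hsub' m1))
  have h3 := (hO (K + i)).1 _ (hsub (hsub' m2))
  have h4 : |(g ((2 * p' + q') / 3))^[K + i] c - (g ((p' + 2 * q') / 3))^[K + i] c| ≤ b - a :=
    abs_le.2 ⟨by linarith [h2.1, h2.2, h3.1, h3.2], by linarith [h2.1, h2.2, h3.1, h3.2]⟩
  rw [div_lt_iff₀ hp] at hi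
  have : 0 ≤ C / (κ - 1) := div_nonneg hC (by linarith)
  nlinarith [mul_nonneg this hp.le]

theorem aux_expand (φ ψ f : ℝ → ℝ) (u w κ₀ κ C : ℝ) (V : Set ℝ)
    (hφ : ∀ x ∈ Icc u w, DifferentiableAt ℝ φ x) (hψ : ∀ x ∈ Icc u w, DifferentiableAt ℝ ψ x)
    (hV : Icc u w ⊆ V)
    (hκ : ∀ x ∈ Icc u w, κ₀ ≤ |deriv φ x|)
    (hclose : ∀ x ∈ V, |iteratedDeriv 1 (fun y => φ y - ψ y) x| ≤ C)
    (hle : κ ≤ κ₀ - C) (heq : EqOn ψ f (Icc u w)) :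
    ∀ z ∈ Icc u w, ∀ y ∈ Icc u w, κ * |z - y| ≤ |f z - f y| := by
  have hd : ∀ x ∈ Icc u w, κ ≤ |deriv ψ x| := by
    intro x hx
    have h1 := hclose x (hV hx)
    rw [iteratedDeriv_one] at h1
    have h2 : deriv (fun y => φ y - ψ y) x = deriv φ x - deriv ψ x :=
      deriv_fun_sub (hφ x hx) (hψ x hx)
    rw [h2] at h1
    have h3 := hκ x hx
    have h4 : |deriv φ x| ≤ |deriv φ x - deriv ψ x| + |deriv ψ x| := by
      simpa using abs_sub_le (deriv φ x) (deriv ψ x) 0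
    linarith
  have key : ∀ z ∈ Icc u w, ∀ y ∈ Icc u w, z < y → κ * |z - y| ≤ |f z - f y| := by
    intro z hz y hy hzy
    have hsub : Icc z y ⊆ Icc u w := Icc_subset_Icc hz.1 hy.2
    obtain ⟨ξ, hξ, hξ'⟩ := exists_deriv_eq_slope ψ hzy
      (fun x hx => (hψ x (hsub hx)).continuousAt.continuousWithinAt)
      (fun x hx => (hψ x (hsub (Ioo_subset_Icc_self hx))).differentiableWithinAt)
    have h5 := hd ξ (hsub (Ioo_subset_Icc_self hξ))
    rw [hξ', abs_div, heq hz, heq hy, abs_sub_comm (f y), abs_sub_comm y,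
      le_div_iff₀ (abs_pos.2 (by intro h; linarith))] at h5
    exact h5
  intro z hz y hy
  rcases lt_trichotomy z y with h | h | h
  · exact key z hz y hy h
  · subst h; simp
  · rw [abs_sub_comm z, abs_sub_comm (f z)]; exact key y hy z hz h

theorem aux_unif (F : PWUnimodal 2) (ε : ℝ) (P : PWFamily 2 2 F ε) :
    ∃ δ > 0, δ ≤ ε ∧ ∃ κ > 1, ∃ C ≥ 0, 
      (∀ t, |t| < δ → ∀ s, |s| < δ → ∀ z ∈ Icc F.a F.b,
        |(P.fam t).f z - (P.fam s).f z| ≤ C * |t - s|) ∧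
      (∀ t, |t| < δ → ∀ z ∈ Icc F.a F.c, ∀ w ∈ Icc F.a F.c,
        κ * |z - w| ≤ |(P.fam t).f z - (P.fam t).f w|) ∧
      (∀ t, |t| < δ → ∀ z ∈ Icc F.c F.b, ∀ w ∈ Icc F.c F.b,
        κ * |z - w| ≤ |(P.fam t).f z - (P.fam t).f w|) ∧
      (∀ t, |t| < δ → ∀ z ∈ Icc F.a F.c, P.Gp (z, t) = (P.fam t).f z) ∧
      (∀ t, |t| < δ → ∀ z ∈ Icc F.c F.b, P.Gm (z, t) = (P.fam t).f z) := by
  obtain ⟨δ₁, hδ₁, C₁, hC₁, h₁⟩ := aux_tube P.Gp P.Wp F.a F.c P.openWp P.subWp P.smoothGp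
  obtain ⟨δ₂, hδ₂, C₂, hC₂, h₂⟩ := aux_tube P.Gm P.Wm F.c F.b P.openWm P.subWm P.smoothGm
  have hκ := F.one_lt_κ
  have hε := P.εpos
  set δ₃ := (F.κ - 1) / (2 * (|P.Cb| + 1)) with hδ₃
  have hδ₃p : 0 < δ₃ := by
    apply div_pos (by linarith)
    positivity
  set δ := min (min δ₁ δ₂) (min δ₃ ε) with hδ
  have l1 : δ ≤ δ₁ := (min_le_left _ _).trans (min_le_left _ _)
  have l2 : δ ≤ δ₂ := (min_le_left _ _).trans (min_le_right _ _)
  have l3 : δ ≤ δ₃ := (min_le_right _ _).trans (min_le_left _ _)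
  have l4 : δ ≤ ε := (min_le_right _ _).trans (min_le_right _ _)
  have hcl : ∀ t, |t| < δ → (F.κ + 1) / 2 ≤ F.κ - P.Cb * |t| := by
    intro t ht
    have h1 : P.Cb * |t| ≤ (|P.Cb| + 1) * δ₃ :=
      mul_le_mul (by linarith [le_abs_self P.Cb]) (by linarith) (abs_nonneg _) (by positivity)
    have h2 : (|P.Cb| + 1) * δ₃ = (F.κ - 1) / 2 := by
      rw [hδ₃]
      have : |P.Cb| + 1 ≠ 0 := by positivity
      field_simp
    linarith
  have gp : ∀ t, |t| < δ → ∀ z ∈ Icc F.a F.c, P.Gp (z, t) = (P.fam t).f z :=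
    fun t ht z hz => P.Gp_eq t (by linarith) z hz (h₁ z hz t t (by linarith) (by linarith)).1
  have gm : ∀ t, |t| < δ → ∀ z ∈ Icc F.c F.b, P.Gm (z, t) = (P.fam t).f z :=
    fun t ht z hz => P.Gm_eq t (by linarith) z hz (h₂ z hz t t (by linarith) (by linarith)).1
  refine ⟨δ, by positivity, l4, (F.κ + 1) / 2, by linarith, C₁ + C₂, by linarith, ?_, ?_, ?_, gp, gm⟩
  · intro t ht s hs z hz
    have h0 := abs_nonneg (t - s)
    rcases le_total z F.c with h | h
    · rw [← gp t ht z ⟨hz.1, h⟩, ← gp s hs z ⟨hz.1, h⟩]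
      have := (h₁ z ⟨hz.1, h⟩ t s (by linarith) (by linarith)).2
      nlinarith
    · rw [← gm t ht z ⟨h, hz.2⟩, ← gm s hs z ⟨h, hz.2⟩]
      have := (h₂ z ⟨h, hz.2⟩ t s (by linarith) (by linarith)).2
      nlinarith
  · intro t ht
    have sub : Icc F.a F.c ⊆ (P.fam t).Up := P.subVp.trans (P.VpUp t (by linarith))
    refine aux_expand F.fp (P.fam t).fp (P.fam t).f F.a F.c F.κ ((F.κ + 1) / 2) (P.Cb * |t|) P.Vp
      ?_ ?_ P.subVp (fun x hx => F.fp_exp x (F.subUp hx))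
      (P.close_p t (by linarith) 1 (by norm_num)) (hcl t ht) ?_
    · intro x hx
      exact (F.fp_smooth.contDiffAt (F.openUp.mem_nhds (F.subUp hx))).differentiableAt (by norm_num)
    · intro x hx
      exact ((P.fam t).fp_smooth.contDiffAt
        ((P.fam t).openUp.mem_nhds (sub hx))).differentiableAt (by norm_num)
    · have := (P.fam t).fp_eq
      rwa [P.same_a, P.same_c] at this
  · intro t ht
    have sub : Icc F.c F.b ⊆ (P.fam t).Um := P.subVm.trans (P.VmUm t (by linarith))
    refine aux_expand F.fm (P.fam t).fm (P.fam t).f F.c F.b F.κ ((F.κ + 1) / 2) (P.Cb * |t|) P.Vm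
      ?_ ?_ P.subVm (fun x hx => F.fm_exp x (F.subUm hx))
      (P.close_m t (by linarith) 1 (by norm_num)) (hcl t ht) ?_
    · intro x hx
      exact (F.fm_smooth.contDiffAt (F.openUm.mem_nhds (F.subUm hx))).differentiableAt (by norm_num)
    · intro x hx
      exact ((P.fam t).fm_smooth.contDiffAt
        ((P.fam t).openUm.mem_nhds (sub hx))).differentiableAt (by norm_num)
    · have := (P.fam t).fm_eq
      rwa [P.same_b, P.same_c] at this

theorem aux_step (G : ℝ × ℝ → ℝ) (W : Set (ℝ × ℝ)) (φ : ℝ → ℝ) (u w x A : ℝ) (e : ℝ → ℝ)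
    (huw : u < w) (hW : IsOpen W) (hx : x ∈ Icc u w) (hxW : (x, (0:ℝ)) ∈ W)
    (hG : ContDiffOn ℝ 2 G W) (hφ : DifferentiableAt ℝ φ x)
    (heq : ∀ y ∈ Icc u w, G (y, 0) = φ y) (he : HasStrictDerivAt e A 0) (he0 : e 0 = x) :
    HasStrictDerivAt (fun t => G (e t, t)) (deriv φ x * A + deriv (fun t => G (x, t)) 0) 0 := by
  have hs : HasStrictFDerivAt G (fderiv ℝ G (x, 0)) (x, 0) :=
    (hG.contDiffAt (hW.mem_nhds hxW)).hasStrictFDerivAt (by norm_num)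
  set L := fderiv ℝ G (x, 0) with hL
  have h1 : HasStrictDerivAt (fun t => (e t, t)) (A, (1:ℝ)) 0 :=
    he.prodMk (hasStrictDerivAt_id 0)
  have hs' : HasStrictFDerivAt G L (e 0, 0) := by rw [he0]; exact hs
  have h2 : HasStrictDerivAt (fun t => G (e t, t)) (L (A, 1)) 0 :=
    HasStrictFDerivAt.comp_hasStrictDerivAt (f := fun t => (e t, t)) 0 hs' h1
  have h3 : HasDerivAt (fun t => G (x, t)) (L (0, 1)) 0 :=
    hs.hasFDerivAt.comp_hasDerivAt (0:ℝ) ((hasDerivAt_const 0 x).prodMk (hasDerivAt_id 0))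
  have h4 : HasDerivAt (fun y => G (y, 0)) (L (1, 0)) x :=
    hs.hasFDerivAt.comp_hasDerivAt x ((hasDerivAt_id x).prodMk (hasDerivAt_const x (0:ℝ)))
  have h5 : deriv φ x = L (1, 0) := by
    have hu : UniqueDiffWithinAt ℝ (Icc u w) x := uniqueDiffOn_Icc huw x hx
    have h6 : HasDerivWithinAt φ (L (1, 0)) (Icc u w) x :=
      h4.hasDerivWithinAt.congr (fun y hy => (heq y hy).symm) (heq x hx).symm
    rw [← h6.derivWithin hu]
    exact (hφ.hasDerivAt.hasDerivWithinAt.derivWithin hu).symm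
  rw [h5, h3.deriv]
  convert h2 using 1
  have : ((A, 1) : ℝ × ℝ) = A • (1, 0) + (0, 1) := by simp
  rw [this, map_add, map_smul, smul_eq_mul, mul_comm]

theorem aux_sign (e : ℝ → ℝ) (A : ℝ) (he : HasDerivAt e A 0) (hA : 0 < A) :
    (∀ᶠ t in 𝓝[>] (0:ℝ), e 0 ≤ e t) ∧ (∀ᶠ t in 𝓝[<] (0:ℝ), e t ≤ e 0) := by
  have h := hasDerivAt_iff_tendsto_slope.1 he
  have h1 : ∀ᶠ t in 𝓝[≠] (0:ℝ), 0 < slope e 0 t := h.eventually_const_lt hA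
  constructor
  · have h2 : ∀ᶠ t in 𝓝[>] (0:ℝ), 0 < slope e 0 t :=
      h1.filter_mono (nhdsWithin_mono _ (fun t ht => ne_of_gt ht))
    filter_upwards [h2, self_mem_nhdsWithin] with t ht ht0
    rw [slope_def_field, sub_zero] at ht
    have ht0 : 0 < t := ht0
    have := (div_pos_iff_of_pos_right ht0).1 ht
    linarith
  · have h2 : ∀ᶠ t in 𝓝[<] (0:ℝ), 0 < slope e 0 t :=
      h1.filter_mono (nhdsWithin_mono _ (fun t ht => ne_of_lt ht))
    filter_upwards [h2, self_mem_nhdsWithin] with t ht ht0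
    rw [slope_def_field, sub_zero] at ht
    have ht0 : t < 0 := ht0
    rcases div_pos_iff.1 ht with h | h <;> linarith

/-- Smooth continuation of the critical orbit along a fixed choice of branches. -/
def eS (Gp Gm : ℝ × ℝ → ℝ) (B : ℕ → Bool) (c : ℝ) : ℕ → ℝ → ℝ
  | 0 => fun _ => c
  | k + 1 => fun t => if B k then Gp (eS Gp Gm B c k t, t) else Gm (eS Gp Gm B c k t, t)

/-- Branch derivative. -/
def DS (F : PWUnimodal 2) (s : Bool) (x : ℝ) : ℝ := if s then deriv F.fp x else deriv F.fm x

/-- Branch deformation. -/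
def VS (F : PWUnimodal 2) (ε : ℝ) (P : PWFamily 2 2 F ε) (s : Bool) (x : ℝ) : ℝ :=
  if s then deriv (fun t => P.Gp (x, t)) 0 else deriv (fun t => P.Gm (x, t)) 0

/-- Derivative of `eS` at zero. -/
def AS (F : PWUnimodal 2) (ε : ℝ) (P : PWFamily 2 2 F ε) (B : ℕ → Bool) : ℕ → ℝ
  | 0 => 0
  | k + 1 => DS F (B k) (F.ck k) * AS F ε P B k + VS F ε P (B k) (F.ck k)

theorem aux_ck_mem (F : PWUnimodal 2) (k : ℕ) : F.ck k ∈ Icc F.a F.b := by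
  induction k with
  | zero => exact ⟨F.hac.le, F.hcb.le⟩
  | succ k ih =>
    unfold PWUnimodal.ck at *
    rw [Function.iterate_succ_apply']
    exact F.mapsI ih

theorem aux_ck_succ (F : PWUnimodal 2) (k : ℕ) : F.ck (k+1) = F.f (F.ck k) := by
  unfold PWUnimodal.ck
  rw [Function.iterate_succ_apply']

theorem aux_strict (F : PWUnimodal 2) (ε : ℝ) (P : PWFamily 2 2 F ε) (B : ℕ → Bool)
    (hB : ∀ k, (B k = true → F.ck k ≤ F.c) ∧ (B k = false → F.c ≤ F.ck k)) (k : ℕ) :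
    HasStrictDerivAt (eS P.Gp P.Gm B F.c k) (AS F ε P B k) 0 ∧
      eS P.Gp P.Gm B F.c k 0 = F.ck k := by
  induction k with
  | zero => exact ⟨hasStrictDerivAt_const _ _, rfl⟩
  | succ k ih =>
    have hm := aux_ck_mem F k
    have e0 : |(0:ℝ)| < ε := by simpa using P.εpos
    have hf0 : (P.fam 0).f = F.f := by rw [P.at0]
    have hp0 : ∀ y ∈ Icc F.a F.c, P.Gp (y, 0) = F.f y := fun y hy => by
      rw [P.Gp_eq 0 e0 y hy (P.subWp ⟨hy, rfl⟩), hf0]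
    have hm0 : ∀ y ∈ Icc F.c F.b, P.Gm (y, 0) = F.f y := fun y hy => by
      rw [P.Gm_eq 0 e0 y hy (P.subWm ⟨hy, rfl⟩), hf0]
    cases hBk : B k with
    | true =>
      have hx : F.ck k ∈ Icc F.a F.c := ⟨hm.1, (hB k).1 hBk⟩
      have := aux_step P.Gp P.Wp F.fp F.a F.c (F.ck k) _ _ F.hac P.openWp hx
        (P.subWp ⟨hx, rfl⟩) P.smoothGp
        ((F.fp_smooth.contDiffAt (F.openUp.mem_nhds (F.subUp hx))).differentiableAt (by norm_num))
        (fun y hy => by rw [hp0 y hy, F.fp_eq hy]) ih.1 ih.2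
      refine ⟨?_, ?_⟩
      · simpa [eS, AS, hBk, DS, VS] using this
      · simp only [eS, hBk, if_true]
        rw [ih.2, hp0 _ hx, aux_ck_succ]
    | false =>
      have hx : F.ck k ∈ Icc F.c F.b := ⟨(hB k).2 hBk, hm.2⟩
      have := aux_step P.Gm P.Wm F.fm F.c F.b (F.ck k) _ _ F.hcb P.openWm hx
        (P.subWm ⟨hx, rfl⟩) P.smoothGm
        ((F.fm_smooth.contDiffAt (F.openUm.mem_nhds (F.subUm hx))).differentiableAt (by norm_num))
        (fun y hy => by rw [hm0 y hy, F.fm_eq hy]) ih.1 ih.2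
      refine ⟨?_, ?_⟩
      · simpa [eS, AS, hBk, DS, VS] using this
      · simp only [eS, hBk, Bool.false_eq_true, if_false]
        rw [ih.2, hm0 _ hx, aux_ck_succ]

theorem aux_finish (F : PWUnimodal 2) (ε : ℝ) (P : PWFamily 2 2 F ε) (B : ℕ → Bool)
    (hB : ∀ k, (B k = true → F.ck k ≤ F.c) ∧ (B k = false → F.c ≤ F.ck k))
    (l : Filter ℝ) (hl0 : l ≤ 𝓝 0) (hl : ∀ s ∈ l, ∃ x y, x < y ∧ Ioo x y ⊆ s)
    (hside : ∀ k, ∀ᶠ t in l, (B k = true → eS P.Gp P.Gm B F.c k t ≤ F.c) ∧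
      (B k = false → F.c ≤ eS P.Gp P.Gm B F.c k t))
    (hA : ∀ M : ℝ, ∃ k, M < |AS F ε P B k|) (η : ℝ) (hη : 0 < η) :
    ∃ t, |t| < η ∧ |t| < ε ∧ Function.Injective fun k : ℕ => ((P.fam t).f)^[k] F.c := by
  obtain ⟨δ, hδ, hδε, κ, hκ, C, hC, hlip, hex1, hex2, hgp, hgm⟩ := aux_unif F ε P
  have hmaps : ∀ t, MapsTo (P.fam t).f (Icc F.a F.b) (Icc F.a F.b) := by
    intro t
    have := (P.fam t).mapsI
    rwa [P.same_a, P.same_b] at this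
  have hcont : ∀ t, ContinuousOn (P.fam t).f (Icc F.a F.b) := by
    intro t
    have := (P.fam t).cont
    rwa [P.same_a, P.same_b] at this
  have hc : F.c ∈ Icc F.a F.b := ⟨F.hac.le, F.hcb.le⟩
  have hmem : ∀ t k, ((P.fam t).f)^[k] F.c ∈ Icc F.a F.b := fun t k => (hmaps t).iterate k hc
  have hδl : ∀ᶠ t in l, |t| < min δ η := by
    apply hl0
    have : ContinuousAt (fun t : ℝ => |t|) 0 := by fun_prop
    exact this.eventually_lt_const (by simpa using ⟨hδ, hη⟩)
  have horb : ∀ k, ∀ᶠ t in l, ((P.fam t).f)^[k] F.c = eS P.Gp P.Gm B F.c k t := by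
    intro k
    induction k with
    | zero => exact Eventually.of_forall fun t => rfl
    | succ k ih =>
      filter_upwards [ih, hside k, hδl] with t h1 h2 h3
      have h3' : |t| < δ := h3.trans_le (min_le_left _ _)
      rw [Function.iterate_succ_apply']
      have hm := hmem t k
      rw [h1] at hm ⊢
      cases hBk : B k with
      | true =>
        simp only [eS, hBk, if_true]
        exact (hgp t h3' _ ⟨hm.1, h2.1 hBk⟩).symm
      | false =>
        simp only [eS, hBk, Bool.false_eq_true, if_false]
        exact (hgm t h3' _ ⟨h2.2 hBk, hm.2⟩).symm
  obtain ⟨K, hK⟩ := hA (C / (κ - 1) + 1)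
  set A := AS F ε P B K with hAdef
  have hst := (aux_strict F ε P B hB K).1
  have hlo := hst.hasStrictFDerivAt.isLittleO.def (c := |A| - (C / (κ - 1) + 1)) (by linarith)
  rw [nhds_prod_eq] at hlo
  obtain ⟨U, hU, hUs⟩ := eventually_prod_self_iff'.1 hlo
  have hev : ∀ᶠ t in l, t ∈ U ∧ |t| < min δ η ∧ ((P.fam t).f)^[K] F.c = eS P.Gp P.Gm B F.c K t :=
    Filter.Eventually.and (p := fun t => t ∈ U) (hl0 hU) (hδl.and (horb K))
  obtain ⟨x, y, hxy, hsub⟩ := hl _ hev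
  have hd : ∀ t ∈ Ioo x y, |t| < δ := fun t ht => (hsub ht).2.1.trans_le (min_le_left _ _)
  obtain ⟨t, ht, hinj⟩ := aux_main (fun t => (P.fam t).f) F.a F.b F.c κ C x y K hxy hc hκ hC
    (fun t _ => hmaps t) (fun t _ => hcont t)
    (fun t ht s hs => hlip t (hd t ht) s (hd s hs))
    (fun t ht => hex1 t (hd t ht)) (fun t ht => hex2 t (hd t ht)) (by
      intro t ht s hs
      have h1 := hUs t (hsub ht).1 s (hsub hs).1
      simp only [(hsub ht).2.2, (hsub hs).2.2]
      simp only [Real.norm_eq_abs, ContinuousLinearMap.toSpanSingleton_apply, smul_eq_mul] at h1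
      have h2 : |(t - s) * A| ≤ |eS P.Gp P.Gm B F.c K t - eS P.Gp P.Gm B F.c K s - (t - s) * A| +
          |eS P.Gp P.Gm B F.c K t - eS P.Gp P.Gm B F.c K s| := by
        have := abs_sub (eS P.Gp P.Gm B F.c K t - eS P.Gp P.Gm B F.c K s)
          (eS P.Gp P.Gm B F.c K t - eS P.Gp P.Gm B F.c K s - (t - s) * A)
        rw [sub_sub_cancel] at this
        linarith
      rw [abs_mul] at h2
      nlinarith)
  exact ⟨t, (hsub ht).2.1.trans_le (min_le_right _ _), (hd t ht).trans_le hδε, hinj⟩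

theorem aux_V0 (F : PWUnimodal 2) (ε : ℝ) (P : PWFamily 2 2 F ε) (s : Bool) :
    VS F ε P s F.c = P.v F.c := by
  cases s with
  | true => simp [VS, PWFamily.v]
  | false =>
    simp only [VS, PWFamily.v, Bool.false_eq_true, if_false, le_refl, if_true]
    obtain ⟨δ, hδ, -, -, -, -, -, -, -, -, hgp, hgm⟩ := aux_unif F ε P
    apply Filter.EventuallyEq.deriv_eq
    have : ContinuousAt (fun t : ℝ => |t|) 0 := by fun_prop
    filter_upwards [this.eventually_lt_const (by simpa using hδ : |(0:ℝ)| < δ)] with t ht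
    rw [hgp t ht _ ⟨F.hac.le, le_rfl⟩, hgm t ht _ ⟨le_rfl, F.hcb.le⟩]

theorem aux_dn_succ (F : PWUnimodal 2) (i : ℕ) :
    F.dn (i + 1) (F.ck 1) = F.dn i (F.ck 1) * F.d (F.ck (i + 1)) := by
  unfold PWUnimodal.dn
  rw [Finset.prod_range_succ]
  rfl

theorem aux_d (F : PWUnimodal 2) (k : ℕ) : F.κ ≤ |F.d (F.ck k)| := by
  have hm := aux_ck_mem F k
  unfold PWUnimodal.d
  split_ifs with h
  · exact F.fp_exp _ (F.subUp ⟨hm.1, h⟩)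
  · exact F.fm_exp _ (F.subUm ⟨(not_le.1 h).le, hm.2⟩)

theorem aux_dn (F : PWUnimodal 2) (i : ℕ) : F.κ ^ i ≤ |F.dn i (F.ck 1)| := by
  induction i with
  | zero => simp [PWUnimodal.dn]
  | succ i ih =>
    rw [aux_dn_succ, abs_mul, pow_succ]
    have := F.one_lt_κ
    exact mul_le_mul ih (aux_d F _) (by linarith) (abs_nonneg _)

theorem aux_dn_ne (F : PWUnimodal 2) (i : ℕ) : F.dn i (F.ck 1) ≠ 0 := by
  have h := aux_dn F i
  have := F.one_lt_κ
  have : 0 < F.κ ^ i := by positivity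
  exact abs_pos.1 (by linarith)

theorem aux_A (F : PWUnimodal 2) (ε : ℝ) (P : PWFamily 2 2 F ε) (B : ℕ → Bool) (N : ℕ)
    (h : ∀ k, 1 ≤ k → k < N → B k = decide (F.ck k ≤ F.c)) (i : ℕ) (hi : i < N) :
    AS F ε P B (i + 1) = F.dn i (F.ck 1) *
      ∑ j ∈ Finset.range (i + 1), P.v (F.ck j) / F.dn j (F.ck 1) := by
  induction i with
  | zero =>
    have : F.ck 0 = F.c := rfl
    simp [AS, PWUnimodal.dn, this, aux_V0]
  | succ i ih =>
    have ih := ih (by omega)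
    have hd : DS F (B (i+1)) (F.ck (i+1)) = F.d (F.ck (i+1)) := by
      rw [h (i+1) (by omega) hi]; simp [DS, PWUnimodal.d]
    have hv : VS F ε P (B (i+1)) (F.ck (i+1)) = P.v (F.ck (i+1)) := by
      rw [h (i+1) (by omega) hi]; simp [VS, PWFamily.v]
    rw [AS, ih, hd, hv, Finset.sum_range_succ _ (i+1), mul_add, mul_div_cancel₀ _ (aux_dn_ne F _),
      aux_dn_succ]
    ring

theorem aux_nonper (F : PWUnimodal 2) (ε : ℝ) (P : PWFamily 2 2 F ε) (hnp : ¬ F.CritPeriodic)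
    (hS : ∑' j : ℕ, P.v (F.ck j) / F.dn j (F.ck 1) ≠ 0) (η : ℝ) (hη : 0 < η) :
    ∃ t, |t| < η ∧ |t| < ε ∧ Function.Injective fun k : ℕ => ((P.fam t).f)^[k] F.c := by
  have hB : ∀ k, ((fun k => decide (F.ck k ≤ F.c)) k = true → F.ck k ≤ F.c) ∧
      ((fun k => decide (F.ck k ≤ F.c)) k = false → F.c ≤ F.ck k) := by
    intro k
    simp only [decide_eq_true_eq, decide_eq_false_iff_not, not_le]
    exact ⟨id, le_of_lt⟩
  set B : ℕ → Bool := fun k => decide (F.ck k ≤ F.c) with hBdef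
  refine aux_finish F ε P B hB (𝓝 0) le_rfl ?_ ?_ ?_ η hη
  · intro s hs
    obtain ⟨x, y, hxy, hsub⟩ := mem_nhds_iff_exists_Ioo_subset.1 hs
    exact ⟨x, y, hxy.1.trans hxy.2, hsub⟩
  · intro k
    rcases Nat.eq_zero_or_pos k with h0 | hk
    · subst h0
      exact Eventually.of_forall fun t => ⟨fun _ => le_rfl, fun _ => le_rfl⟩
    have hne : F.ck k ≠ F.c := fun h => hnp ⟨k, hk, h⟩
    obtain ⟨h1, h2⟩ := aux_strict F ε P B hB k
    have hct : ContinuousAt (eS P.Gp P.Gm B F.c k) 0 := h1.hasDerivAt.continuousAt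
    rcases lt_or_gt_of_ne hne with h | h
    · filter_upwards [hct.eventually_lt_const (h2 ▸ h)] with t ht
      refine ⟨fun _ => ht.le, fun hf => ?_⟩
      exact absurd ((hB k).2 hf) (not_le.2 h)
    · filter_upwards [hct.eventually_const_lt (h2 ▸ h)] with t ht
      refine ⟨fun hf => ?_, fun _ => ht.le⟩
      exact absurd ((hB k).1 hf) (not_le.2 h)
  · intro M
    have hsum : Summable fun j : ℕ => P.v (F.ck j) / F.dn j (F.ck 1) := by
      by_contra hns
      exact hS (tsum_eq_zero_of_not_summable hns)
    set S := ∑' j : ℕ, P.v (F.ck j) / F.dn j (F.ck 1) with hSdef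
    have htend := (hsum.hasSum.tendsto_sum_nat).abs
    have hpos : 0 < |S| := abs_pos.2 hS
    have hev := htend.eventually_const_lt (show |S| / 2 < |S| by linarith)
    have hpow := tendsto_pow_atTop_atTop_of_one_lt F.one_lt_κ
    obtain ⟨n, hn1, hn2⟩ := ((hev.and_frequently
      ((hpow.eventually_gt_atTop (M / (|S| / 2) * F.κ)).frequently)).and_eventually
        (eventually_gt_atTop 0)).exists
    obtain ⟨i, rfl⟩ : ∃ i, n = i + 1 := ⟨n - 1, by omega⟩
    refine ⟨i + 1, ?_⟩
    rw [aux_A F ε P B (i + 1) (fun k _ _ => rfl) i (by omega), abs_mul]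
    have hd := aux_dn F i
    have hκ := F.one_lt_κ
    have h3 : M / (|S| / 2) < F.κ ^ i := by
      have := hn1.2
      rw [pow_succ] at this
      exact lt_of_mul_lt_mul_right this (by linarith)
    rw [div_lt_iff₀ (by linarith)] at h3
    have h4 : F.κ ^ i * (|S| / 2) ≤ |F.dn i (F.ck 1)| *
        |∑ j ∈ Finset.range (i + 1), P.v (F.ck j) / F.dn j (F.ck 1)| :=
      mul_le_mul hd hn1.1.le (by linarith) (abs_nonneg _)
    linarith

theorem aux_fp_pos (F : PWUnimodal 2) : 0 < deriv F.fp F.c := by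
  have hx : F.c ∈ Icc F.a F.c := ⟨F.hac.le, le_rfl⟩
  have hd : DifferentiableAt ℝ F.fp F.c :=
    (F.fp_smooth.contDiffAt (F.openUp.mem_nhds (F.subUp hx))).differentiableAt (by norm_num)
  have hm : MonotoneOn F.fp (Icc F.a F.c) := by
    intro x hx y hy hxy
    rw [F.fp_eq hx, F.fp_eq hy]
    exact F.mono.monotoneOn hx hy hxy
  have h1 : 0 ≤ derivWithin F.fp (Icc F.a F.c) F.c := hm.derivWithin_nonneg
  rw [hd.derivWithin (uniqueDiffOn_Icc F.hac _ hx)] at h1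
  have h2 := F.fp_exp _ (F.subUp hx)
  rw [abs_of_nonneg h1] at h2
  linarith [F.one_lt_κ]

theorem aux_fm_neg (F : PWUnimodal 2) : deriv F.fm F.c < 0 := by
  have hx : F.c ∈ Icc F.c F.b := ⟨le_rfl, F.hcb.le⟩
  have hd : DifferentiableAt ℝ F.fm F.c :=
    (F.fm_smooth.contDiffAt (F.openUm.mem_nhds (F.subUm hx))).differentiableAt (by norm_num)
  have hm : AntitoneOn F.fm (Icc F.c F.b) := by
    intro x hx y hy hxy
    rw [F.fm_eq hx, F.fm_eq hy]
    exact F.anti.antitoneOn hx hy hxy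
  have h1 : derivWithin F.fm (Icc F.c F.b) F.c ≤ 0 := hm.derivWithin_nonpos
  rw [hd.derivWithin (uniqueDiffOn_Icc F.hcb _ hx)] at h1
  have h2 := F.fm_exp _ (F.subUm hx)
  rw [abs_of_nonpos h1] at h2
  linarith [F.one_lt_κ]

theorem aux_per (F : PWUnimodal 2) (ε : ℝ) (P : PWFamily 2 2 F ε) (hp : F.CritPeriodic)
    (hS : ∑ j ∈ Finset.range (Function.minimalPeriod F.f F.c),
      P.v (F.ck j) / F.dn j (F.ck 1) ≠ 0) (η : ℝ) (hη : 0 < η) :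
    ∃ t, |t| < η ∧ |t| < ε ∧ Function.Injective fun k : ℕ => ((P.fam t).f)^[k] F.c := by
  obtain ⟨n, hn0, hn⟩ := hp
  have hpp : 0 < Function.minimalPeriod F.f F.c :=
    Function.IsPeriodicPt.minimalPeriod_pos hn0 hn
  set p := Function.minimalPeriod F.f F.c with hpdef
  obtain ⟨q, hq⟩ : ∃ q, p = q + 1 := ⟨p - 1, by omega⟩
  have hckc : ∀ k, F.ck k = F.c ↔ p ∣ k := fun k => Function.isPeriodicPt_iff_minimalPeriod_dvd
  have hcp : F.ck p = F.c := (hckc p).2 dvd_rfl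
  have hper : ∀ l i, F.ck (l * p + i) = F.ck i := by
    intro l i
    have h1 : F.ck (l * p) = F.c := (hckc _).2 (dvd_mul_left _ _)
    unfold PWUnimodal.ck at *
    rw [Nat.add_comm, Function.iterate_add_apply, h1]
  set σ : Bool := decide (0 < F.dn q (F.ck 1)) with hσ
  set B : ℕ → Bool := fun k => if p ∣ k then σ else decide (F.ck k ≤ F.c) with hBdef
  have hB : ∀ k, (B k = true → F.ck k ≤ F.c) ∧ (B k = false → F.c ≤ F.ck k) := by
    intro k
    by_cases h : p ∣ k
    · rw [(hckc k).2 h]; exact ⟨fun _ => le_rfl, fun _ => le_rfl⟩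
    · simp only [hBdef, h, if_false, decide_eq_true_eq, decide_eq_false_iff_not, not_le]
      exact ⟨id, le_of_lt⟩
  have hBper : ∀ l i, B (l * p + i) = B i := by
    intro l i
    have : p ∣ l * p + i ↔ p ∣ i := (Nat.dvd_add_right (dvd_mul_left _ _))
    simp only [hBdef, this, hper]
  have hBlt : ∀ k, 1 ≤ k → k < p → B k = decide (F.ck k ≤ F.c) := by
    intro k h1 h2
    have : ¬ p ∣ k := fun h => by have := Nat.le_of_dvd (by omega) h; omega
    simp only [hBdef, this, if_false]
  have hB0 : B 0 = σ := by simp [hBdef]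
  -- first return
  have hAp : AS F ε P B p ≠ 0 := by
    have h1 := aux_A F ε P B p hBlt q (by omega)
    rw [← hq] at h1
    rw [h1]
    exact mul_ne_zero (aux_dn_ne F q) hS
  -- multiplier
  set lam := DS F σ F.c * F.dn q (F.ck 1) with hlam
  have hlam1 : 1 ≤ lam := by
    have hκ := F.one_lt_κ
    have h0 : 0 < lam := by
      rcases lt_or_gt_of_ne (aux_dn_ne F q) with h | h
      · have : σ = false := by simp [hσ, h.le]
        rw [hlam, this]
        simpa [DS] using mul_pos_of_neg_of_neg (aux_fm_neg F) h
      · have : σ = true := by simp [hσ, h]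
        rw [hlam, this]
        simpa [DS] using mul_pos (aux_fp_pos F) h
    have h1 : 1 ≤ |DS F σ F.c| := by
      cases σ with
      | true => exact hκ.le.trans (F.fp_exp _ (F.subUp ⟨F.hac.le, le_rfl⟩))
      | false => exact hκ.le.trans (F.fm_exp _ (F.subUm ⟨le_rfl, F.hcb.le⟩))
    have h2 : 1 ≤ |F.dn q (F.ck 1)| := (one_le_pow₀ hκ.le).trans (aux_dn F q)
    rw [← abs_of_pos h0, hlam, abs_mul]
    nlinarith
  have hrec : ∀ l i, i < p → AS F ε P B (l * p + (i + 1)) = AS F ε P B (i + 1) +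
      DS F σ F.c * F.dn i (F.ck 1) * AS F ε P B (l * p) := by
    intro l i
    induction i with
    | zero =>
      intro _
      have h0 := hBper l 0
      have h1 := hper l 0
      rw [Nat.add_zero] at h0 h1
      have h2 : F.ck 0 = F.c := rfl
      simp only [AS, Nat.zero_add, h0, h1, hB0, h2, PWUnimodal.dn, Finset.range_zero,
        Finset.prod_empty]
      ring
    | succ i ih =>
      intro hi
      have ih := ih (by omega)
      have hd : DS F (B (i+1)) (F.ck (i+1)) = F.d (F.ck (i+1)) := by
        rw [hBlt (i+1) (by omega) hi]; simp [DS, PWUnimodal.d]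
      rw [show l * p + (i + 1 + 1) = (l * p + (i + 1)) + 1 by ring, AS, hBper, hper, ih,
        AS.eq_2 F ε P B (i+1), aux_dn_succ, hd]
      ring
  have hgeo : ∀ l : ℕ, ∃ g : ℝ, (l : ℝ) ≤ g ∧ AS F ε P B (l * p) = AS F ε P B p * g := by
    intro l
    induction l with
    | zero => exact ⟨0, by simp, by simp [AS]⟩
    | succ l ih =>
      obtain ⟨g, hg, hg'⟩ := ih
      have h0 : (0:ℝ) ≤ l := Nat.cast_nonneg l
      refine ⟨1 + lam * g, by push_cast; nlinarith, ?_⟩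
      have := hrec l q (by omega)
      rw [← hq] at this
      rw [Nat.succ_mul, this, hg', hlam]
      ring
  have hunb : ∀ M : ℝ, ∃ k, M < |AS F ε P B k| := by
    intro M
    have hpos : 0 < |AS F ε P B p| := abs_pos.2 hAp
    obtain ⟨l, hl⟩ := exists_nat_gt (M / |AS F ε P B p|)
    obtain ⟨g, hg, hg'⟩ := hgeo l
    refine ⟨l * p, ?_⟩
    rw [hg', abs_mul]
    rw [div_lt_iff₀ hpos] at hl
    have := le_abs_self g
    nlinarith
  -- sides
  have hgen : ∀ l : Filter ℝ, l ≤ 𝓝 0 → (∀ k, 0 < k → p ∣ k → ∀ᶠ t in l,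
      (σ = true → eS P.Gp P.Gm B F.c k t ≤ F.c) ∧
      (σ = false → F.c ≤ eS P.Gp P.Gm B F.c k t)) → 
      ∀ k, ∀ᶠ t in l, (B k = true → eS P.Gp P.Gm B F.c k t ≤ F.c) ∧
      (B k = false → F.c ≤ eS P.Gp P.Gm B F.c k t) := by
    intro l hl hlk k
    rcases Nat.eq_zero_or_pos k with h0 | hk
    · subst h0
      exact Eventually.of_forall fun t => ⟨fun _ => le_rfl, fun _ => le_rfl⟩
    by_cases hpk : p ∣ k
    · have : B k = σ := by simp [hBdef, hpk]
      rw [this]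
      exact hlk k hk hpk
    have hne : F.ck k ≠ F.c := fun h => hpk ((hckc k).1 h)
    obtain ⟨h1, h2⟩ := aux_strict F ε P B hB k
    have hct : ContinuousAt (eS P.Gp P.Gm B F.c k) 0 := h1.hasDerivAt.continuousAt
    apply hl
    rcases lt_or_gt_of_ne hne with h | h
    · filter_upwards [hct.eventually_lt_const (h2 ▸ h)] with t ht
      refine ⟨fun _ => ht.le, fun hf => ?_⟩
      exact absurd ((hB k).2 hf) (not_le.2 h)
    · filter_upwards [hct.eventually_const_lt (h2 ▸ h)] with t ht
      refine ⟨fun hf => ?_, fun _ => ht.le⟩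
      exact absurd ((hB k).1 hf) (not_le.2 h)
  have hret : ∀ k, 0 < k → p ∣ k → HasDerivAt (eS P.Gp P.Gm B F.c k) (AS F ε P B k) 0 ∧
      eS P.Gp P.Gm B F.c k 0 = F.c ∧ ∃ g : ℝ, 0 < g ∧ AS F ε P B k = AS F ε P B p * g := by
    intro k hk hpk
    obtain ⟨h1, h2⟩ := aux_strict F ε P B hB k
    refine ⟨h1.hasDerivAt, h2.trans ((hckc k).2 hpk), ?_⟩
    obtain ⟨l, rfl⟩ := hpk
    obtain ⟨g, hg, hg'⟩ := hgeo l
    rw [Nat.mul_comm]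
    refine ⟨g, lt_of_lt_of_le ?_ hg, hg'⟩
    have : 0 < l := Nat.pos_of_mul_pos_left hk
    exact_mod_cast this
  have hR : ∀ s ∈ 𝓝[>] (0:ℝ), ∃ x y, x < y ∧ Ioo x y ⊆ s := by
    intro s hs
    obtain ⟨u, hu, hus⟩ := mem_nhdsGT_iff_exists_Ioo_subset.1 hs
    exact ⟨0, u, hu, hus⟩
  have hL : ∀ s ∈ 𝓝[<] (0:ℝ), ∃ x y, x < y ∧ Ioo x y ⊆ s := by
    intro s hs
    obtain ⟨u, hu, hus⟩ := mem_nhdsLT_iff_exists_Ioo_subset.1 hs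
    exact ⟨u, 0, hu, hus⟩
  have pos_case : 0 < AS F ε P B p → ∀ k, 0 < k → p ∣ k →
      (∀ᶠ t in 𝓝[>] (0:ℝ), F.c ≤ eS P.Gp P.Gm B F.c k t) ∧
      (∀ᶠ t in 𝓝[<] (0:ℝ), eS P.Gp P.Gm B F.c k t ≤ F.c) := by
    intro h k hk hpk
    obtain ⟨h1, h2, g, hg, hg'⟩ := hret k hk hpk
    have := aux_sign _ _ h1 (by rw [hg']; exact mul_pos h hg)
    rwa [h2] at this
  have neg_case : AS F ε P B p < 0 → ∀ k, 0 < k → p ∣ k →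
      (∀ᶠ t in 𝓝[>] (0:ℝ), eS P.Gp P.Gm B F.c k t ≤ F.c) ∧
      (∀ᶠ t in 𝓝[<] (0:ℝ), F.c ≤ eS P.Gp P.Gm B F.c k t) := by
    intro h k hk hpk
    obtain ⟨h1, h2, g, hg, hg'⟩ := hret k hk hpk
    have := aux_sign _ _ h1.neg (by rw [hg']; nlinarith)
    simpa [h2] using this
  rcases lt_or_gt_of_ne hAp with hneg | hpos <;> cases hσc : σ
  · refine aux_finish F ε P B hB (𝓝[<] 0) nhdsWithin_le_nhds hL
      (hgen _ nhdsWithin_le_nhds fun k hk hpk => ?_) hunb η hη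
    filter_upwards [(neg_case hneg k hk hpk).2] with t ht
    exact ⟨fun h => by simp [hσc] at h, fun _ => ht⟩
  · refine aux_finish F ε P B hB (𝓝[>] 0) nhdsWithin_le_nhds hR
      (hgen _ nhdsWithin_le_nhds fun k hk hpk => ?_) hunb η hη
    filter_upwards [(neg_case hneg k hk hpk).1] with t ht
    exact ⟨fun _ => ht, fun h => by simp [hσc] at h⟩
  · refine aux_finish F ε P B hB (𝓝[>] 0) nhdsWithin_le_nhds hR
      (hgen _ nhdsWithin_le_nhds fun k hk hpk => ?_) hunb η hη
    filter_upwards [(pos_case hpos k hk hpk).1] with t ht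
    exact ⟨fun h => by simp [hσc] at h, fun _ => ht⟩
  · refine aux_finish F ε P B hB (𝓝[<] 0) nhdsWithin_le_nhds hL
      (hgen _ nhdsWithin_le_nhds fun k hk hpk => ?_) hunb η hη
    filter_upwards [(pos_case hpos k hk hpk).2] with t ht
    exact ⟨fun _ => ht, fun h => by simp [hσc] at h⟩

/-- Lemma 7.2. If the infinitesimal deformation of a `C^{2,2}` perturbation
of a mixing piecewise expanding `C²` unimodal map is not horizontal, then there is a sequence
`t_n → 0` such that `c` has an infinite forward orbit under each `f_{t_n}`. -/
theorem stmt_17 (F : PWUnimodal 2) (hmix : F.Mixing)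
    (ε : ℝ) (P : PWFamily 2 2 F ε)
    (hnh : ¬ F.Horizontal P.v) :
    ∃ t : ℕ → ℝ, Filter.Tendsto t Filter.atTop (nhds 0) ∧ (∀ n, |t n| < ε) ∧
      ∀ n, Function.Injective fun k : ℕ => ((P.fam (t n)).f)^[k] F.c := by
  have key : ∀ η : ℝ, 0 < η →
      ∃ t, |t| < η ∧ |t| < ε ∧ Function.Injective fun k : ℕ => ((P.fam t).f)^[k] F.c := by
    intro η hη
    by_cases hp : F.CritPeriodic
    · refine aux_per F ε P hp (fun h => hnh ⟨fun _ => h, fun h' => absurd hp h'⟩) η hη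
    · refine aux_nonper F ε P hp (fun h => hnh ⟨fun h' => absurd h' hp, fun _ => h⟩) η hη
  choose t ht using fun n : ℕ => key (1 / ((n : ℝ) + 1)) (by positivity)
  refine ⟨t, ?_, fun n => (ht n).2.1, fun n => (ht n).2.2⟩
  exact squeeze_zero_norm (fun n => (ht n).1.le) tendsto_one_div_add_atTop_nhds_zero_nat

end
end
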